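/- arXiv:2511.20374 — 10 statements merged into one kernel-verified Lean document; each statement's English description precedes it below -/
import Mathlib

section
/- The squeezed-join operator sj is a regular linear extension operator: for all functions p, q : X × X → ℝ and all reals a, b, sj(a·p + b·q) = a·sj(p) + b·sj(q); if p(x,x') ≥ 0 for all x, x' ∈ X then sj(p)(u,v) ≥ 0 for all u, v ∈ X × X × [0,1]; if p is the constant function 1 then sj(p) is the constant function 1; and for all x, x' ∈ X and all s, s' ∈ [0,1], sj(p)((x,x,s),(x',x',s')) = p(x,x') (so sj(p) extends p along the canonical embedding x ↦ (x,x,s)). -/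
/-- The squeezed-join operator given by the great magic formula. A point of the
squeezed join is represented as `(x, y, t) : X × X × unitInterval`. -/
noncomputable def sj {X : Type*} (p : X × X → ℝ) :
    (X × X × unitInterval) × (X × X × unitInterval) → ℝ :=
  fun w =>
    min (1 - (w.1.2.2 : ℝ)) (1 - (w.2.2.2 : ℝ)) * p (w.1.1, w.2.1) +
    max 0 ((w.2.2.2 : ℝ) - (w.1.2.2 : ℝ)) * p (w.1.1, w.2.2.1) +
    max 0 ((w.1.2.2 : ℝ) - (w.2.2.2 : ℝ)) * p (w.1.2.1, w.2.1) +
    min ((w.1.2.2 : ℝ)) ((w.2.2.2 : ℝ)) * p (w.1.2.1, w.2.2.1)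

theorem sj_weights_sum (s t : ℝ) :
    min (1 - s) (1 - t) + max 0 (t - s) + max 0 (s - t) + min s t = 1 := by
  rcases le_total s t with h | h
  · rw [min_eq_right (by linarith), max_eq_right (by linarith), max_eq_left (by linarith),
      min_eq_left h]
    ring
  · rw [min_eq_left (by linarith), max_eq_left (by linarith), max_eq_right (by linarith),
      min_eq_right h]
    ring

theorem sj_nonneg {X : Type*} {p : X × X → ℝ} (hp : ∀ z, 0 ≤ p z)
    (w : (X × X × unitInterval) × (X × X × unitInterval)) : 0 ≤ sj p w := by
  have h₁ : 0 ≤ min (1 - (w.1.2.2 : ℝ)) (1 - (w.2.2.2 : ℝ)) :=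
    le_min (unitInterval.one_minus_nonneg _) (unitInterval.one_minus_nonneg _)
  have h₂ : 0 ≤ min (w.1.2.2 : ℝ) (w.2.2.2 : ℝ) :=
    le_min (unitInterval.nonneg _) (unitInterval.nonneg _)
  exact add_nonneg (add_nonneg (add_nonneg (mul_nonneg h₁ (hp _))
    (mul_nonneg (le_max_left _ _) (hp _))) (mul_nonneg (le_max_left _ _) (hp _)))
    (mul_nonneg h₂ (hp _))

/-- `sj` is a regular linear extension operator. -/
theorem sj_regular_linear_extension {X : Type*} :
    (∀ (p q : X × X → ℝ) (a b : ℝ),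
      sj (fun z => a * p z + b * q z) = fun w => a * sj p w + b * sj q w) ∧
    (∀ p : X × X → ℝ, (∀ z, 0 ≤ p z) → ∀ w, 0 ≤ sj p w) ∧
    (sj (fun _ : X × X => (1 : ℝ)) = fun _ => (1 : ℝ)) ∧
    (∀ (p : X × X → ℝ) (x x' : X) (s s' : unitInterval),
      sj p ((x, x, s), (x', x', s')) = p (x, x')) := by
  refine ⟨fun p q a b => ?_, fun p hp w => sj_nonneg hp w, ?_, fun p x x' s s' => ?_⟩
  · funext w
    simp only [sj]
    ring
  · funext w
    simpa only [sj, mul_one] using sj_weights_sum (w.1.2.2 : ℝ) (w.2.2.2 : ℝ)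
  · simp only [sj]
    rw [← add_mul, ← add_mul, ← add_mul, sj_weights_sum, one_mul]
end

section
/- Let a, b ∈ X, ε > 0, M ≥ 0, and let p : X × X → ℝ satisfy |p(z,z')| ≤ M for all z, z' ∈ X. Let U_a, U_b ⊆ X be sets such that |p(x,y) − p(a,b)| < ε for every x ∈ U_a and y ∈ U_b. Then for every δ > 0 and all points u ∈ [U_a, δ] and v ∈ [U_b, δ] one has |sj(p)(u,v) − p(a,b)| < ε + 4δM. -/
/-- For `U ⊆ X` and `δ > 0`, the set `[U, δ]` of points `(x,y,t)` of the squeezed join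
with `x ∈ U` and `y ∈ U`, or `x ∈ U` and `t < δ`, or `y ∈ U` and `t > 1 - δ`. -/
def tube {X : Type*} (U : Set X) (δ : ℝ) : Set (X × X × unitInterval) :=
  {w | (w.1 ∈ U ∧ w.2.1 ∈ U) ∨ (w.1 ∈ U ∧ (w.2.2 : ℝ) < δ) ∨
    (w.2.1 ∈ U ∧ 1 - δ < (w.2.2 : ℝ))}

/-- The barycentric mass that a point of the squeezed join puts outside `U`. -/
noncomputable def massOutside {X : Type*} (U : Set X) (w : X × X × unitInterval) : ℝ :=
  (1 - (w.2.2 : ℝ)) * Uᶜ.indicator 1 w.1 + (w.2.2 : ℝ) * Uᶜ.indicator 1 w.2.1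

lemma massOutside_lt_of_mem_tube {X : Type*} {U : Set X} {δ : ℝ} (hδ : 0 < δ)
    {w : X × X × unitInterval} (hw : w ∈ tube U δ) : massOutside U w < δ := by
  obtain ⟨x, y, t, ht₀, ht₁⟩ := w
  simp only [tube, Set.mem_ofPred_eq] at hw
  by_cases hx : x ∈ U <;> by_cases hy : y ∈ U <;>
    simp [massOutside, hx, hy] at hw ⊢ <;> linarith

/-- The coefficients of the great magic formula form a coupling of `(1 - s, s)` and
`(1 - t, t)`. -/
lemma exists_coupling_sj {X : Type*} (x y x' y' : X) (s t : unitInterval) :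
    ∃ A B C D : ℝ, 0 ≤ A ∧ 0 ≤ B ∧ 0 ≤ C ∧ 0 ≤ D ∧
      (s : ℝ) = C + D ∧ (t : ℝ) = B + D ∧ A + B + C + D = 1 ∧
      ∀ p : X × X → ℝ, sj p ((x, y, s), (x', y', t)) =
        A * p (x, x') + B * p (x, y') + C * p (y, x') + D * p (y, y') := by
  obtain ⟨s, hs₀, hs₁⟩ := s
  obtain ⟨t, ht₀, ht₁⟩ := t
  refine ⟨min (1 - s) (1 - t), max 0 (t - s), max 0 (s - t), min s t, ?_, le_max_left _ _,
    le_max_left _ _, le_min hs₀ ht₀, ?_, ?_, ?_, fun p => rfl⟩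
  · exact le_min (by linarith) (by linarith)
  all_goals
    rcases le_total s t with h | h
    · simp [h, min_sub_sub_left]
    · simp [h, min_sub_sub_left]

lemma abs_sj_sub_le {X : Type*} {p : X × X → ℝ} {c ε K : ℝ} {Ua Ub : Set X}
    (h : ∀ z z' : X,
      |p (z, z') - c| ≤ ε + K * (Uaᶜ.indicator 1 z + Ubᶜ.indicator 1 z'))
    (u v : X × X × unitInterval) :
    |sj p (u, v) - c| ≤ ε + K * (massOutside Ua u + massOutside Ub v) := by
  obtain ⟨x, y, s⟩ := u
  obtain ⟨x', y', t⟩ := v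
  obtain ⟨A, B, C, D, hA, hB, hC, hD, hs, ht, hsum, hsj⟩ := exists_coupling_sj x y x' y' s t
  obtain rfl : A = 1 - B - C - D := by linarith
  rw [hsj]
  simp only [massOutside, hs, ht]
  have h₁ := abs_le.1 (h x x')
  have h₂ := abs_le.1 (h x y')
  have h₃ := abs_le.1 (h y x')
  have h₄ := abs_le.1 (h y y')
  refine abs_le.2 ⟨?_, ?_⟩
  · linarith [mul_le_mul_of_nonneg_left h₁.1 hA, mul_le_mul_of_nonneg_left h₂.1 hB,
      mul_le_mul_of_nonneg_left h₃.1 hC, mul_le_mul_of_nonneg_left h₄.1 hD]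
  · linarith [mul_le_mul_of_nonneg_left h₁.2 hA, mul_le_mul_of_nonneg_left h₂.2 hB,
      mul_le_mul_of_nonneg_left h₃.2 hC, mul_le_mul_of_nonneg_left h₄.2 hD]

theorem sj_local_estimate {X : Type*} (a b : X) (ε M : ℝ) (hε : 0 < ε) (hM : 0 ≤ M)
    (p : X × X → ℝ) (hp : ∀ z z' : X, |p (z, z')| ≤ M)
    (Ua Ub : Set X) (hU : ∀ x ∈ Ua, ∀ y ∈ Ub, |p (x, y) - p (a, b)| < ε) :
    ∀ δ : ℝ, 0 < δ → ∀ u ∈ tube Ua δ, ∀ v ∈ tube Ub δ,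
      |sj p (u, v) - p (a, b)| < ε + 4 * δ * M := by
  intro δ hδ u hu v hv
  rcases hM.eq_or_lt with rfl | hM
  · have hp₀ : ∀ z z' : X, p (z, z') = 0 := fun z z' => abs_nonpos_iff.1 (hp z z')
    simpa [sj, hp₀] using hε
  have hpair : ∀ z z' : X, |p (z, z') - p (a, b)| ≤
      ε + 2 * M * (Uaᶜ.indicator 1 z + Ubᶜ.indicator 1 z') := by
    intro z z'
    have hle : |p (z, z') - p (a, b)| ≤ 2 * M :=
      (abs_sub _ _).trans (by linarith [hp z z', hp a b])
    by_cases hz : z ∈ Ua <;> by_cases hz' : z' ∈ Ub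
    · simpa [hz, hz'] using (hU z hz z' hz').le
    all_goals
      simp only [Set.indicator, Set.mem_compl_iff, hz, hz', not_true_eq_false,
        not_false_eq_true, if_true, if_false, Pi.one_apply]
      linarith
  have hbad : massOutside Ua u + massOutside Ub v < 2 * δ := by
    linarith [massOutside_lt_of_mem_tube hδ hu, massOutside_lt_of_mem_tube hδ hv]
  calc |sj p (u, v) - p (a, b)|
      ≤ ε + 2 * M * (massOutside Ua u + massOutside Ub v) := abs_sj_sub_le hpair u v
    _ < ε + 2 * M * (2 * δ) := by gcongr
    _ = ε + 4 * δ * M := by ring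
end

section
/- If p : X × X → ℝ is a pseudometric on X, then sj(p) is a pseudometric on X × X × [0,1]: sj(p)(u,v) ≥ 0, sj(p)(u,u) = 0, sj(p)(u,v) = sj(p)(v,u), and sj(p)(u,w) ≤ sj(p)(u,v) + sj(p)(v,w) for all u, v, w ∈ X × X × [0,1]. -/
/-- `p : Z × Z → ℝ` is a pseudometric. -/
def IsPseudometric {Z : Type*} (p : Z × Z → ℝ) : Prop :=
  (∀ x y : Z, 0 ≤ p (x, y)) ∧ (∀ x : Z, p (x, x) = 0) ∧
  (∀ x y : Z, p (x, y) = p (y, x)) ∧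
  (∀ x y z : Z, p (x, z) ≤ p (x, y) + p (y, z))

/-- Value of `sj p` when the first parameter is at most the second. -/
theorem sj_apply_of_le {X : Type*} (p : X × X → ℝ) (a a' b b' : X) {r s : unitInterval}
    (h : (r : ℝ) ≤ s) :
    sj p ((a, a', r), (b, b', s)) =
      (1 - s) * p (a, b) + (s - r) * p (a, b') + r * p (a', b') := by
  simp [sj, h, min_eq_right (sub_le_sub_left h 1)]

/-- Value of `sj p` when the second parameter is at most the first. -/
theorem sj_apply_of_ge {X : Type*} (p : X × X → ℝ) (a a' b b' : X) {r s : unitInterval}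
    (h : (s : ℝ) ≤ r) :
    sj p ((a, a', r), (b, b', s)) =
      (1 - r) * p (a, b) + (r - s) * p (a', b) + s * p (a', b') := by
  simp [sj, h, min_eq_left (sub_le_sub_left h 1)]

/-- `sj` sends pseudometrics to pseudometrics. -/
theorem sj_pseudometric {X : Type*} (p : X × X → ℝ) (hp : IsPseudometric p) :
    IsPseudometric (sj p) := by
  obtain ⟨hnonneg, hself, hsymm, htri⟩ := hp
  refine ⟨?_, ?_, ?_, ?_⟩
  · rintro ⟨a, a', r⟩ ⟨b, b', s⟩
    have hmin := le_min (sub_nonneg.2 r.2.2) (sub_nonneg.2 s.2.2)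
    have hmin' := le_min r.2.1 s.2.1
    have := hnonneg a b
    have := hnonneg a b'
    have := hnonneg a' b
    have := hnonneg a' b'
    simp only [sj]
    positivity
  · rintro ⟨a, a', r⟩
    simp [sj, hself]
  · rintro ⟨a, a', r⟩ ⟨b, b', s⟩
    simp only [sj, hsymm b, hsymm b', min_comm (1 - (s : ℝ)), min_comm (s : ℝ)]
    ring
  · rintro ⟨a, a', r⟩ ⟨b, b', s⟩ ⟨c, c', t⟩
    -- Sorting the parameters splits `[0, 1]` into four intervals; on each of them the inequality
    -- is the triangle inequality for `p`, weighted by the length of the interval.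
    rcases le_total (r : ℝ) s with hrs | hsr <;> rcases le_total (s : ℝ) t with hst | hts
    · rw [sj_apply_of_le _ _ _ _ _ hrs, sj_apply_of_le _ _ _ _ _ hst,
        sj_apply_of_le _ _ _ _ _ (hrs.trans hst)]
      linarith [mul_le_mul_of_nonneg_left (htri a' b' c') r.2.1,
        mul_le_mul_of_nonneg_left (htri a b' c') (sub_nonneg.2 hrs),
        mul_le_mul_of_nonneg_left (htri a b c') (sub_nonneg.2 hst),
        mul_le_mul_of_nonneg_left (htri a b c) (sub_nonneg.2 t.2.2)]
    · rcases le_total (r : ℝ) t with hrt | htr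
      · rw [sj_apply_of_le _ _ _ _ _ hrs, sj_apply_of_ge _ _ _ _ _ hts,
          sj_apply_of_le _ _ _ _ _ hrt]
        linarith [mul_le_mul_of_nonneg_left (htri a' b' c') r.2.1,
          mul_le_mul_of_nonneg_left (htri a b' c') (sub_nonneg.2 hrt),
          mul_le_mul_of_nonneg_left (htri a b' c) (sub_nonneg.2 hts),
          mul_le_mul_of_nonneg_left (htri a b c) (sub_nonneg.2 s.2.2)]
      · rw [sj_apply_of_le _ _ _ _ _ hrs, sj_apply_of_ge _ _ _ _ _ hts,
          sj_apply_of_ge _ _ _ _ _ htr]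
        linarith [mul_le_mul_of_nonneg_left (htri a' b' c') t.2.1,
          mul_le_mul_of_nonneg_left (htri a' b' c) (sub_nonneg.2 htr),
          mul_le_mul_of_nonneg_left (htri a b' c) (sub_nonneg.2 hrs),
          mul_le_mul_of_nonneg_left (htri a b c) (sub_nonneg.2 s.2.2)]
    · rcases le_total (r : ℝ) t with hrt | htr
      · rw [sj_apply_of_ge _ _ _ _ _ hsr, sj_apply_of_le _ _ _ _ _ hst,
          sj_apply_of_le _ _ _ _ _ hrt]
        linarith [mul_le_mul_of_nonneg_left (htri a' b' c') s.2.1,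
          mul_le_mul_of_nonneg_left (htri a' b c') (sub_nonneg.2 hsr),
          mul_le_mul_of_nonneg_left (htri a b c') (sub_nonneg.2 hrt),
          mul_le_mul_of_nonneg_left (htri a b c) (sub_nonneg.2 t.2.2)]
      · rw [sj_apply_of_ge _ _ _ _ _ hsr, sj_apply_of_le _ _ _ _ _ hst,
          sj_apply_of_ge _ _ _ _ _ htr]
        linarith [mul_le_mul_of_nonneg_left (htri a' b' c') s.2.1,
          mul_le_mul_of_nonneg_left (htri a' b c') (sub_nonneg.2 hst),
          mul_le_mul_of_nonneg_left (htri a' b c) (sub_nonneg.2 htr),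
          mul_le_mul_of_nonneg_left (htri a b c) (sub_nonneg.2 r.2.2)]
    · rw [sj_apply_of_ge _ _ _ _ _ hsr, sj_apply_of_ge _ _ _ _ _ hts,
        sj_apply_of_ge _ _ _ _ _ (hts.trans hsr)]
      linarith [mul_le_mul_of_nonneg_left (htri a' b' c') t.2.1,
        mul_le_mul_of_nonneg_left (htri a' b' c) (sub_nonneg.2 hts),
        mul_le_mul_of_nonneg_left (htri a' b c) (sub_nonneg.2 hsr),
        mul_le_mul_of_nonneg_left (htri a b c) (sub_nonneg.2 r.2.2)]
end

section
/- Let p : X × X → ℝ be a metric on X. Call a point u = (x,y,t) ∈ X × X × [0,1] degenerate with base z ∈ X if (t = 0 and x = z), or (t = 1 and y = z), or (x = y = z). Then for u = (x,y,t) and v = (x',y',t') in X × X × [0,1], sj(p)(u,v) = 0 if and only if either (x = x' and y = y' and t = t'), or there exists z ∈ X such that both u and v are degenerate with base z. (Thus sj(p) induces a genuine metric on the squeezed join, the quotient of X × X × [0,1] by this relation.) -/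
/-- `p : Z × Z → ℝ` is a metric: a pseudometric separating points. -/
def IsMetricFun {Z : Type*} (p : Z × Z → ℝ) : Prop :=
  IsPseudometric p ∧ ∀ x y : Z, p (x, y) = 0 → x = y

/-- A point `(x, y, t)` of `X × X × [0,1]` is degenerate with base `z` if `t = 0` and
`x = z`, or `t = 1` and `y = z`, or `x = y = z`. -/
def Degenerate {X : Type*} (u : X × X × unitInterval) (z : X) : Prop :=
  ((u.2.2 : ℝ) = 0 ∧ u.1 = z) ∨ ((u.2.2 : ℝ) = 1 ∧ u.2.1 = z) ∨ (u.1 = z ∧ u.2.1 = z)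

/-- A sum of four products of nonnegative reals vanishes iff each product does. -/
theorem sum_four_mul_eq_zero_iff {a b c d p q r s : ℝ} (ha : 0 ≤ a) (hb : 0 ≤ b) (hc : 0 ≤ c)
    (hd : 0 ≤ d) (hp : 0 ≤ p) (hq : 0 ≤ q) (hr : 0 ≤ r) (hs : 0 ≤ s) :
    a * p + b * q + c * r + d * s = 0 ↔
      (a = 0 ∨ p = 0) ∧ (b = 0 ∨ q = 0) ∧ (c = 0 ∨ r = 0) ∧ (d = 0 ∨ s = 0) := by
  rw [add_eq_zero_iff_of_nonneg (by positivity) (by positivity),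
    add_eq_zero_iff_of_nonneg (by positivity) (by positivity),
    add_eq_zero_iff_of_nonneg (by positivity) (by positivity)]
  simp only [mul_eq_zero, and_assoc]

/-- For a metric `p` on `X`, the vanishing of `sj p` at a pair of points is
characterized exactly as identification in the squeezed join. -/
theorem sj_zero_iff {X : Type*} (p : X × X → ℝ) (hp : IsMetricFun p)
    (u v : X × X × unitInterval) :
    sj p (u, v) = 0 ↔
      (u.1 = v.1 ∧ u.2.1 = v.2.1 ∧ u.2.2 = v.2.2) ∨
      (∃ z : X, Degenerate u z ∧ Degenerate v z) := by
  obtain ⟨⟨hnonneg, hself, -, -⟩, hsep⟩ := hp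
  have hzero (x y : X) : p (x, y) = 0 ↔ x = y := ⟨hsep x y, fun h => h ▸ hself x⟩
  obtain ⟨x, y, t, ht0, ht1⟩ := u
  obtain ⟨x', y', t', ht0', ht1'⟩ := v
  simp only [sj, Degenerate]
  rw [sum_four_mul_eq_zero_iff (le_min (by linarith) (by linarith)) (le_max_left _ _)
    (le_max_left _ _) (le_min ht0 ht0') (hnonneg _ _) (hnonneg _ _) (hnonneg _ _) (hnonneg _ _)]
  simp only [hzero]
  constructor
  · rintro ⟨hxx, hxy, hyx, hyy⟩
    rcases lt_trichotomy t t' with h | rfl | h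
    · right
      use x
      grind
    · by_cases h0 : t = 0
      · right
        use x
        grind
      · by_cases h1 : t = 1
        · right
          use y
          grind
        · grind
    · right
      use y
      grind
  · rintro (⟨rfl, rfl, htt⟩ | ⟨z, hu, hv⟩)
    · obtain rfl : t = t' := congrArg Subtype.val htt
      simp
    · grind
end

section
/- If p : X × X → ℝ is a totally bounded pseudometric on X, then sj(p) is a totally bounded pseudometric on X × X × [0,1]: for every ε > 0 there exists a finite set B ⊆ X × X × [0,1] such that for every u ∈ X × X × [0,1] there is b ∈ B with sj(p)(u,b) < ε. -/
theorem IsPseudometric.sj {X : Type*} {p : X × X → ℝ} (hp : IsPseudometric p) :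
    IsPseudometric (sj p) := by
  obtain ⟨h0, hd, hs, ht⟩ := hp
  refine ⟨?_, ?_, ?_, ?_⟩
  · rintro ⟨x, y, t, t0, t1⟩ ⟨x', y', t', t0', t1'⟩
    have a := mul_nonneg (le_min (sub_nonneg.2 t1) (sub_nonneg.2 t1')) (h0 x x')
    have b := mul_nonneg (le_max_left 0 (t' - t)) (h0 x y')
    have c := mul_nonneg (le_max_left 0 (t - t')) (h0 y x')
    have d := mul_nonneg (le_min t0 t0') (h0 y y')
    simp only [_root_.sj]
    linarith
  · rintro ⟨x, y, t⟩
    simp [_root_.sj, hd]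
  · rintro ⟨x, y, t⟩ ⟨x', y', t'⟩
    simp only [_root_.sj]
    rw [min_comm, min_comm (t : ℝ), hs x x', hs x y', hs y x', hs y y']
    ring
  · rintro ⟨x₁, y₁, t₁, l₁, u₁⟩ ⟨x₂, y₂, t₂, l₂, u₂⟩ ⟨x₃, y₃, t₃, l₃, u₃⟩
    have key {c d : ℝ} (hcd : c ≤ d) (a b e : X) :
        (d - c) * p (a, e) ≤ (d - c) * p (a, b) + (d - c) * p (b, e) := by
      rw [← mul_add]
      exact mul_le_mul_of_nonneg_left (ht a b e) (sub_nonneg.2 hcd)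
    simp only [_root_.sj]
    rcases le_total t₁ t₂ with h₁₂ | h₁₂ <;> rcases le_total t₂ t₃ with h₂₃ | h₂₃
    · have h₁₃ := h₁₂.trans h₂₃
      have := key l₁ y₁ y₂ y₃
      have := key h₁₂ x₁ y₂ y₃
      have := key h₂₃ x₁ x₂ y₃
      have := key u₃ x₁ x₂ x₃
      simp only [*, min_sub_sub_left, max_eq_left, max_eq_right, min_eq_left,
        sub_nonneg, sub_nonpos]
      linarith
    · rcases le_total t₁ t₃ with h₁₃ | h₁₃
      · have := key l₁ y₁ y₂ y₃
        have := key h₁₃ x₁ y₂ y₃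
        have := key h₂₃ x₁ y₂ x₃
        have := key u₂ x₁ x₂ x₃
        simp only [*, min_sub_sub_left, max_eq_left, max_eq_right, min_eq_left, min_eq_right,
          sub_nonneg, sub_nonpos]
        linarith
      · have := key l₃ y₁ y₂ y₃
        have := key h₁₃ y₁ y₂ x₃
        have := key h₁₂ x₁ y₂ x₃
        have := key u₂ x₁ x₂ x₃
        simp only [*, min_sub_sub_left, max_eq_left, max_eq_right, min_eq_left, min_eq_right,
          sub_nonneg, sub_nonpos]
        linarith
    · rcases le_total t₁ t₃ with h₁₃ | h₁₃
      · have := key l₂ y₁ y₂ y₃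
        have := key h₁₂ y₁ x₂ y₃
        have := key h₁₃ x₁ x₂ y₃
        have := key u₃ x₁ x₂ x₃
        simp only [*, min_sub_sub_left, max_eq_left, max_eq_right, min_eq_left, min_eq_right,
          sub_nonneg, sub_nonpos]
        linarith
      · have := key l₂ y₁ y₂ y₃
        have := key h₂₃ y₁ x₂ y₃
        have := key h₁₃ y₁ x₂ x₃
        have := key u₁ x₁ x₂ x₃
        simp only [*, min_sub_sub_left, max_eq_left, max_eq_right, min_eq_left, min_eq_right,
          sub_nonneg, sub_nonpos]
        linarith
    · have h₁₃ := h₂₃.trans h₁₂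
      have := key l₃ y₁ y₂ y₃
      have := key h₂₃ y₁ y₂ x₃
      have := key h₁₂ y₁ x₂ x₃
      have := key u₁ x₁ x₂ x₃
      simp only [*, min_sub_sub_left, max_eq_left, max_eq_right, min_eq_right,
        sub_nonneg, sub_nonpos]
      linarith

theorem sj_same_parameter {X : Type*} (p : X × X → ℝ) (x y a b : X) (t : unitInterval) :
    sj p ((x, y, t), (a, b, t)) = (1 - (t : ℝ)) * p (x, a) + t * p (y, b) := by
  simp [sj]

theorem sj_same_endpoints {X : Type*} {p : X × X → ℝ} (hp : IsPseudometric p) (a b : X)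
    (t s : unitInterval) :
    sj p ((a, b, t), (a, b, s)) = dist t s * p (a, b) := by
  obtain ⟨-, hd, hs, -⟩ := hp
  simp only [sj, hd, hs b a, Subtype.dist_eq, Real.dist_eq]
  rcases le_total (t : ℝ) s with h | h
  · rw [max_eq_right (sub_nonneg.2 h), max_eq_left (sub_nonpos.2 h),
      abs_of_nonpos (sub_nonpos.2 h)]
    ring
  · rw [max_eq_left (sub_nonpos.2 h), max_eq_right (sub_nonneg.2 h),
      abs_of_nonneg (sub_nonneg.2 h)]
    ring

/-- `sj` sends totally bounded pseudometrics to totally bounded pseudometrics. -/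
theorem sj_totallyBounded {X : Type*} (p : X × X → ℝ) (hp : IsPseudometric p)
    (htb : ∀ ε : ℝ, 0 < ε → ∃ A : Finset X, ∀ x : X, ∃ a ∈ A, p (x, a) < ε) :
    IsPseudometric (sj p) ∧
    ∀ ε : ℝ, 0 < ε → ∃ B : Finset (X × X × unitInterval),
      ∀ u : X × X × unitInterval, ∃ b ∈ B, sj p (u, b) < ε := by
  classical
  refine ⟨hp.sj, fun ε hε => ?_⟩
  obtain ⟨A, hA⟩ := htb (ε / 2) (half_pos hε)
  set M := ∑ q ∈ A ×ˢ A, p q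
  have hM : 0 ≤ M := Finset.sum_nonneg fun q _ => hp.1 q.1 q.2
  have hδ : 0 < ε / 2 / (M + 1) := by positivity
  obtain ⟨T, -, hTfin, hT⟩ :=
    Metric.finite_approx_of_totallyBounded (isCompact_univ (X := unitInterval)).totallyBounded _ hδ
  refine ⟨A ×ˢ A ×ˢ hTfin.toFinset, ?_⟩
  rintro ⟨x, y, t⟩
  obtain ⟨a, haA, ha⟩ := hA x
  obtain ⟨b, hbA, hb⟩ := hA y
  obtain ⟨s, hsT, hs⟩ := Set.mem_iUnion₂.1 (hT (Set.mem_univ t))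
  refine ⟨(a, b, s), by simp [haA, hbA, hsT], ?_⟩
  have hab : p (a, b) ≤ M :=
    Finset.single_le_sum (fun q _ => hp.1 q.1 q.2) (Finset.mk_mem_product haA hbA)
  have hts : dist t s * (M + 1) < ε / 2 := (lt_div_iff₀ (by positivity)).1 hs
  have h₁ : (1 - (t : ℝ)) * p (x, a) + t * p (y, b) < ε / 2 := by
    rcases t.2.1.eq_or_lt with h | h
    · simpa [← h] using ha
    · nlinarith [mul_lt_mul_of_pos_left hb h,
        mul_le_mul_of_nonneg_left ha.le (sub_nonneg.2 t.2.2)]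
  have h₂ : dist t s * p (a, b) ≤ dist t s * (M + 1) :=
    mul_le_mul_of_nonneg_left (by linarith) dist_nonneg
  have h₃ := hp.sj.2.2.2 (x, y, t) (a, b, t) (a, b, s)
  rw [sj_same_parameter, sj_same_endpoints hp] at h₃
  linarith
end

section
/- Let d₁ and d₂ be metrics on a set X such that d₂ is bounded and d₁ dominates d₂, i.e., for every x ∈ X and ε > 0 there exists δ > 0 such that d₁(x,x') < δ implies d₂(x,x') < ε for all x' ∈ X. Then sj(d₁) dominates sj(d₂) on X × X × [0,1]: for every u ∈ X × X × [0,1] and every ε > 0 there exists δ > 0 such that sj(d₁)(u,v) < δ implies sj(d₂)(u,v) < ε for all v ∈ X × X × [0,1]. -/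
/-- Multiplying by weights in `[0, 1]` preserves domination at a point of a bounded function,
uniformly in the weights. -/
theorem exists_weighted_dominates {X : Type*} {d₁ d₂ : X × X → ℝ} {M : ℝ} {a : X}
    (h₂ : ∀ b : X, 0 ≤ d₂ (a, b)) (hM : ∀ b : X, d₂ (a, b) ≤ M)
    (hdom : ∀ ε : ℝ, 0 < ε → ∃ δ : ℝ, 0 < δ ∧ ∀ b : X, d₁ (a, b) < δ → d₂ (a, b) < ε)
    {ε : ℝ} (hε : 0 < ε) :
    ∃ δ : ℝ, 0 < δ ∧ ∀ (c : ℝ) (b : X), 0 ≤ c → c ≤ 1 →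
      c * d₁ (a, b) < δ → c * d₂ (a, b) < ε := by
  obtain ⟨δ, hδ, h⟩ := hdom ε hε
  have hM0 : 0 ≤ M := (h₂ a).trans (hM a)
  refine ⟨δ * (ε / (M + 1)), by positivity, fun c b hc hc1 hcd => ?_⟩
  rcases lt_or_ge (d₁ (a, b)) δ with hlt | hge
  · exact (mul_le_of_le_one_left (h₂ b) hc1).trans_lt (h b hlt)
  · have hcε : c < ε / (M + 1) := by
      refine lt_of_mul_lt_mul_left ?_ hδ.le
      calc δ * c = c * δ := mul_comm _ _
        _ ≤ c * d₁ (a, b) := mul_le_mul_of_nonneg_left hge hc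
        _ < δ * (ε / (M + 1)) := hcd
    calc c * d₂ (a, b) ≤ c * (M + 1) :=
          mul_le_mul_of_nonneg_left ((hM b).trans (by linarith)) hc
      _ < ε := (lt_div_iff₀ (by linarith)).mp hcε

/-- If `d₁` dominates the bounded metric `d₂`, then `sj d₁` dominates `sj d₂`. -/
theorem sj_dominates {X : Type*} (d₁ d₂ : X × X → ℝ)
    (h₁ : IsMetricFun d₁) (h₂ : IsMetricFun d₂)
    (M : ℝ) (hM : ∀ x y : X, d₂ (x, y) ≤ M)
    (hdom : ∀ x : X, ∀ ε : ℝ, 0 < ε → ∃ δ : ℝ, 0 < δ ∧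
      ∀ x' : X, d₁ (x, x') < δ → d₂ (x, x') < ε) :
    ∀ u : X × X × unitInterval, ∀ ε : ℝ, 0 < ε → ∃ δ : ℝ, 0 < δ ∧
      ∀ v : X × X × unitInterval, sj d₁ (u, v) < δ → sj d₂ (u, v) < ε := by
  rintro ⟨x, y, t, ht0, ht1⟩ ε hε
  obtain ⟨δx, hδx, hx⟩ := exists_weighted_dominates (h₂.1.1 x) (hM x) (hdom x)
    (show 0 < ε / 4 by positivity)
  obtain ⟨δy, hδy, hy⟩ := exists_weighted_dominates (h₂.1.1 y) (hM y) (hdom y)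
    (show 0 < ε / 4 by positivity)
  refine ⟨min δx δy, lt_min hδx hδy, ?_⟩
  rintro ⟨x', y', t', ht0', ht1'⟩ hsj
  simp only [sj] at hsj ⊢
  have hxx0 : 0 ≤ min (1 - t) (1 - t') := le_min (by linarith) (by linarith)
  have hxx1 : min (1 - t) (1 - t') ≤ 1 := (min_le_left _ _).trans (by linarith)
  have hxy0 : 0 ≤ max 0 (t' - t) := le_max_left _ _
  have hxy1 : max 0 (t' - t) ≤ 1 := max_le zero_le_one (by linarith)
  have hyx0 : 0 ≤ max 0 (t - t') := le_max_left _ _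
  have hyx1 : max 0 (t - t') ≤ 1 := max_le zero_le_one (by linarith)
  have hyy0 : 0 ≤ min t t' := le_min ht0 ht0'
  have hyy1 : min t t' ≤ 1 := (min_le_left _ _).trans ht1
  have pxx := mul_nonneg hxx0 (h₁.1.1 x x')
  have pxy := mul_nonneg hxy0 (h₁.1.1 x y')
  have pyx := mul_nonneg hyx0 (h₁.1.1 y x')
  have pyy := mul_nonneg hyy0 (h₁.1.1 y y')
  obtain ⟨hsx, hsy⟩ := lt_min_iff.mp hsj
  have qxx := hx _ x' hxx0 hxx1 (by linarith)
  have qxy := hx _ y' hxy0 hxy1 (by linarith)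
  have qyx := hy _ x' hyx0 hyx1 (by linarith)
  have qyy := hy _ y' hyy0 hyy1 (by linarith)
  linarith
end

section
/- Let Y be a metrizable topological space and X ⊆ Y a closed subset containing at least two points, equipped with the subspace topology. Then there exists a regular extension operator T : (X × X → ℝ) → (Y × Y → ℝ) such that: (i) for every M ≥ 0, if |p(x,x')| ≤ M for all x, x' ∈ X then |T(p)(y,y')| ≤ M for all y, y' ∈ Y; (ii) if p is continuous on X × X then T(p) is continuous on Y × Y; (iii) if p is a pseudometric on X then T(p) is a pseudometric on Y; (iv) if p is a metric on X then T(p) is a metric on Y. -/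
/-- `T` is a regular extension operator from functions on `X × X` to functions
on `Y × Y`: linear, positive, unit-preserving, and extending. -/
def IsRegularExtensionOperator {Y : Type*} (X : Set Y)
    (T : (↥X × ↥X → ℝ) → (Y × Y → ℝ)) : Prop :=
  (∀ (p q : ↥X × ↥X → ℝ) (a b : ℝ),
    T (fun z => a * p z + b * q z) = fun w => a * T p w + b * T q w) ∧
  (∀ p : ↥X × ↥X → ℝ, (∀ z, 0 ≤ p z) → ∀ w, 0 ≤ T p w) ∧
  (T (fun _ => 1) = fun _ => 1) ∧
  (∀ (p : ↥X × ↥X → ℝ) (x x' : ↥X), T p ((x : Y), (x' : Y)) = p (x, x'))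

open MeasureTheory Set Filter Topology

/-- The set of indices at which a bump covering exceeds the level `t`, as a simple function of
`t`. Only indices with a nonzero value at `y` are recorded, so that it is always finite. -/
noncomputable def BumpCovering.superlevel {ι U : Type*} [TopologicalSpace U]
    (b : BumpCovering ι U) (y : U) : SimpleFunc ℝ (Set ι) where
  toFun t := {i | b i y ≠ 0 ∧ t < b i y}
  measurableSet_fiber' S := by
    have hfin := b.point_finite y
    have h : (fun t : ℝ => {i | b i y ≠ 0 ∧ t < b i y}) ⁻¹' {S} =
        (⋂ i ∈ {i | b i y ≠ 0}, {t : ℝ | t < b i y ↔ i ∈ S}) ∩ {_t | S ⊆ {i | b i y ≠ 0}} := by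
      ext t
      simp only [mem_preimage, mem_singleton_iff, mem_inter_iff, mem_iInter, mem_ofPred_eq]
      constructor
      · rintro rfl
        exact ⟨fun i hi => by simp [hi], fun i hi => hi.1⟩
      · rintro ⟨h₁, h₂⟩
        ext i
        exact ⟨fun hi => (h₁ i hi.1).1 hi.2, fun hi => ⟨h₂ hi, (h₁ i (h₂ hi)).2 hi⟩⟩
    rw [h]
    refine (MeasurableSet.biInter hfin.countable fun i _ => ?_).inter (MeasurableSet.const _)
    by_cases hi : i ∈ S
    · simpa only [hi, iff_true] using measurableSet_lt measurable_id' measurable_const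
    · simpa only [hi, iff_false, not_lt] using measurableSet_le measurable_const measurable_id'
  finite_range' := (b.point_finite y).finite_subsets.subset <| by
    rintro _ ⟨t, rfl⟩ i hi
    exact hi.1

theorem BumpCovering.eventually_superlevel_subset {ι U : Type*} [TopologicalSpace U]
    (b : BumpCovering ι U) (a : U) :
    ∃ F : Set ι, F.Finite ∧ ∀ᶠ y in 𝓝 a, ∀ t, b.superlevel y t ⊆ F := by
  obtain ⟨V, hV, hF⟩ := b.locallyFinite a
  exact ⟨_, hF, mem_of_superset hV fun y hy t i hi => ⟨y, hi.1, hy⟩⟩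

theorem BumpCovering.eventually_superlevel_eq {ι U : Type*} [TopologicalSpace U]
    (b : BumpCovering ι U) (a : U) {t : ℝ} (ht : 0 < t) (hta : ∀ i, b i a ≠ 0 → t ≠ b i a) :
    ∀ᶠ y in 𝓝 a, b.superlevel y t = b.superlevel a t := by
  obtain ⟨F, hF, hsub⟩ := b.eventually_superlevel_subset a
  have hloc : ∀ᶠ y in 𝓝 a, ∀ i ∈ F, (t < b i y ↔ t < b i a) := by
    refine (eventually_all_finite hF).2 fun i _ => ?_
    have hc : ContinuousAt (b i) a := (b i).continuous.continuousAt
    have hne : t ≠ b i a := by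
      by_cases h : b i a = 0
      · exact h ▸ ht.ne'
      · exact hta i h
    rcases hne.lt_or_gt with h | h
    · filter_upwards [hc.eventually (lt_mem_nhds h)] with y hy using iff_of_true hy h
    · filter_upwards [hc.eventually (gt_mem_nhds h)] with y hy
        using iff_of_false hy.not_gt h.not_gt
  filter_upwards [hsub, hloc] with y hy hyF
  ext i
  constructor
  · intro hi
    have : t < b i a := (hyF i (hy t hi)).1 hi.2
    exact ⟨(ht.trans this).ne', this⟩
  · intro hi
    have : t < b i y := (hyF i (hsub.self_of_nhds t hi)).2 hi.2
    exact ⟨(ht.trans this).ne', this⟩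

/-- A random choice of an almost nearest point of `X`, locally finite and stochastically
continuous on the complement of `X`. -/
theorem exists_random_selection {Y : Type*} [MetricSpace Y] {X : Set Y} (hX : IsClosed X)
    (hne : X.Nonempty) :
    ∃ h : ↥Xᶜ → SimpleFunc ℝ ↥X,
      (∀ y : ↥Xᶜ, ∀ t ∈ Ioo (0 : ℝ) 1, dist (y : Y) (h y t) < 2 * Metric.infDist (y : Y) X) ∧
      (∀ a, ∃ F : Set ↥X, F.Finite ∧ ∀ᶠ y in 𝓝 a, ∀ t ∈ Ioo (0 : ℝ) 1, h y t ∈ F) ∧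
      (∀ a, ∀ᵐ t : ℝ, t ∈ Ioo (0 : ℝ) 1 → ∀ᶠ y in 𝓝 a, h y t = h a t) := by
  classical
  have : Nonempty ↥X := hne.to_subtype
  obtain ⟨b, hb⟩ := BumpCovering.exists_isSubordinate (X := ↥Xᶜ) isClosed_univ
    (fun x : ↥X => {y : ↥Xᶜ | dist (y : Y) x < 2 * Metric.infDist (y : Y) X})
    (fun x => isOpen_lt (by fun_prop)
      (continuous_const.mul ((Metric.continuous_infDist_pt X).comp continuous_subtype_val)))
    (fun y _ => by
      have hpos : 0 < Metric.infDist (y : Y) X := (hX.notMem_iff_infDist_pos hne).1 y.2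
      obtain ⟨x, hx, hlt⟩ := (Metric.infDist_lt_iff hne).1
        (show Metric.infDist (y : Y) X < 2 * Metric.infDist (y : Y) X by linarith)
      exact mem_iUnion.2 ⟨⟨x, hx⟩, hlt⟩)
  let c : Set ↥X → ↥X := fun S => if h : S.Nonempty then h.some else Classical.arbitrary _
  have hc : ∀ y, ∀ t ∈ Ioo (0 : ℝ) 1, c (b.superlevel y t) ∈ b.superlevel y t := by
    intro y t ht
    have h : (b.superlevel y t).Nonempty := by
      have h1 := b.ind_apply y (mem_univ y)
      exact ⟨b.ind y (mem_univ y), by rw [h1]; exact one_ne_zero, by rw [h1]; exact ht.2⟩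
    simp only [c, dif_pos h]
    exact h.some_mem
  refine ⟨fun y => (b.superlevel y).map c, fun y t ht => ?_, fun a => ?_, fun a => ?_⟩
  · exact hb _ (subset_tsupport _ (hc y t ht).1)
  · obtain ⟨F, hF, hsub⟩ := b.eventually_superlevel_subset a
    exact ⟨F, hF, hsub.mono fun y hy t ht => hy t (hc y t ht)⟩
  · have hnull : ∀ᵐ t : ℝ, t ∉ (fun i => b i a) '' {i | b i a ≠ 0} :=
      ((b.point_finite a).image _).countable.ae_notMem _
    filter_upwards [hnull] with t ht ht01
    filter_upwards [b.eventually_superlevel_eq a ht01.1 fun i hi h => ht ⟨i, hi, h.symm⟩] with y hy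
    simp only [SimpleFunc.map_apply, hy]

/-- A stochastically continuous random map from `Y` to the disjoint union of `X` and a second copy
of `Y`, which is the identity on `X` and hits the second copy with positive probability
elsewhere. -/
theorem exists_random_map {Y : Type*} [MetricSpace Y] {X : Set Y} (hX : IsClosed X)
    (hne : X.Nonempty) :
    ∃ G : Y → SimpleFunc ℝ (↥X ⊕ Y),
      (∀ (x : ↥X) t, G x t = Sum.inl x) ∧
      (∀ y ∉ X, ∃ ε > 0, ∀ t < ε, G y t = Sum.inr y) ∧
      (∀ a, ∃ K : Set (↥X ⊕ Y), K.Finite ∧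
        Tendsto (fun q : Y × ℝ => G q.1 q.2) (𝓝 a ×ˢ 𝓟 (Ioo 0 1)) (𝓝ˢ K)) ∧
      (∀ a, ∀ᵐ t : ℝ, t ∈ Ioo (0 : ℝ) 1 → ContinuousAt (fun y => G y t) a) := by
  classical
  obtain ⟨h, hdist, hfin, hcont⟩ := exists_random_selection hX hne
  have hopen : IsOpen Xᶜ := hX.isOpen_compl
  let D : Y → ℝ := fun y => Metric.infDist y X
  have hD : Continuous D := Metric.continuous_infDist_pt X
  let G : Y → SimpleFunc ℝ (↥X ⊕ Y) := fun y =>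
    if hy : y ∈ X then SimpleFunc.const ℝ (Sum.inl ⟨y, hy⟩)
    else SimpleFunc.piecewise (Iio (D y)) measurableSet_Iio (SimpleFunc.const ℝ (Sum.inr y))
      ((h ⟨y, hy⟩).map Sum.inl)
  have hG_mem : ∀ (x : ↥X) t, G x t = Sum.inl x := fun x t => by simp [G]
  have hG_lt : ∀ y ∉ X, ∀ t < D y, G y t = Sum.inr y := fun y hy t ht => by simp [G, hy, ht]
  have hG_ge : ∀ (y : ↥Xᶜ) t, D y ≤ t → G y t = Sum.inl (h y t) := fun y t ht => by
    have hy : (y : Y) ∉ X := y.2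
    simp [G, hy, ht]
  -- near a point of `X`, the first copy is only hit close to that point
  have hnear : ∀ (a : ↥X), ∀ V ∈ 𝓝 a, ∀ᶠ y : Y in 𝓝 (a : Y), ∀ t ∈ Ioo (0 : ℝ) 1,
      (D y ≤ t ∨ y ∈ X) → G y t ∈ Sum.inl '' V := by
    intro a V hV
    obtain ⟨ε, hε, hball⟩ := Metric.mem_nhds_iff.1 hV
    filter_upwards [Metric.ball_mem_nhds (a : Y) (show 0 < ε / 3 by positivity)] with y hy t ht hor
    rw [Metric.mem_ball] at hy
    by_cases hyX : y ∈ X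
    · refine ⟨⟨y, hyX⟩, hball ?_, (hG_mem ⟨y, hyX⟩ t).symm⟩
      rw [Metric.mem_ball, Subtype.dist_eq]
      exact hy.trans (by linarith)
    · refine ⟨h ⟨y, hyX⟩ t, hball ?_, (hG_ge ⟨y, hyX⟩ t (hor.resolve_right hyX)).symm⟩
      have h1 := hdist ⟨y, hyX⟩ t ht
      have h2 : Metric.infDist y X ≤ dist y a := Metric.infDist_le_dist_of_mem a.2
      have h3 := dist_triangle_left (h ⟨y, hyX⟩ t : Y) a y
      rw [Metric.mem_ball, Subtype.dist_eq]
      linarith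
  refine ⟨G, hG_mem, fun y hy => ⟨D y, (hX.notMem_iff_infDist_pos hne).1 hy, hG_lt y hy⟩,
    fun a => ?_, fun a => ?_⟩
  · by_cases ha : a ∈ X
    · refine ⟨{Sum.inl ⟨a, ha⟩, Sum.inr a}, by simp, ?_⟩
      intro O hO
      rw [nhdsSet_insert, nhdsSet_singleton, mem_sup, nhds_inl, nhds_inr] at hO
      have hev : ∀ᶠ y in 𝓝 a, ∀ t ∈ Ioo (0 : ℝ) 1, G y t ∈ O := by
        filter_upwards [hnear ⟨a, ha⟩ _ hO.1, hO.2] with y hy hyr t ht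
        by_cases hcase : D y ≤ t ∨ y ∈ X
        · obtain ⟨x, hx, hxe⟩ := hy t ht hcase
          exact hxe ▸ hx
        · push Not at hcase
          rw [hG_lt y hcase.2 t hcase.1]
          exact hyr
      exact eventually_prod_principal_iff.2 hev
    · obtain ⟨F, hF, hev⟩ := hfin ⟨a, ha⟩
      refine ⟨insert (Sum.inr a) (Sum.inl '' F), (hF.image _).insert _, ?_⟩
      intro O hO
      rw [nhdsSet_insert, mem_sup, nhds_inr] at hO
      have hFO : Sum.inl '' F ⊆ O := subset_of_mem_nhdsSet hO.2
      have hev' : ∀ᶠ y in 𝓝 a, ∀ hy : y ∉ X, ∀ t ∈ Ioo (0 : ℝ) 1, h ⟨y, hy⟩ t ∈ F := by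
        rw [nhds_subtype_eq_comap, eventually_comap] at hev
        exact hev.mono fun y hy hyX => hy ⟨y, hyX⟩ rfl
      refine eventually_prod_principal_iff.2 ?_
      filter_upwards [hev', hO.1, hopen.mem_nhds ha] with y hy hyr hyX t ht
      rcases lt_or_ge t (D y) with hlt | hge
      · simp only [hG_lt y hyX t hlt]
        exact hyr
      · simp only [hG_ge ⟨y, hyX⟩ t hge]
        exact hFO ⟨_, hy hyX t ht, rfl⟩
  · by_cases ha : a ∈ X
    · refine Eventually.of_forall fun t ht => ?_
      rw [ContinuousAt, hG_mem ⟨a, ha⟩, nhds_inl]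
      intro O hO
      have hDa : D a < t := by
        simpa only [D, Metric.infDist_zero_of_mem ha] using ht.1
      change ∀ᶠ y in 𝓝 a, G y t ∈ O
      filter_upwards [hnear ⟨a, ha⟩ _ hO, hD.continuousAt.eventually (gt_mem_nhds hDa)]
        with y hy hlt
      obtain ⟨x, hx, hxe⟩ := hy t ht (Or.inl hlt.le)
      exact hxe ▸ hx
    · have hne' : ∀ᵐ t : ℝ, t ∉ ({D a} : Set ℝ) := (countable_singleton _).ae_notMem _
      filter_upwards [hcont ⟨a, ha⟩, hne'] with t ht htD ht01
      rcases lt_or_gt_of_ne (show t ≠ D a from htD) with hlt | hgt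
      · have : (fun y => G y t) =ᶠ[𝓝 a] Sum.inr := by
          filter_upwards [hopen.mem_nhds ha, hD.continuousAt.eventually (lt_mem_nhds hlt)]
            with y hy hy' using hG_lt y hy t hy'
        exact continuous_inr.continuousAt.congr this.symm
      · have hev := ht ht01
        rw [nhds_subtype_eq_comap, eventually_comap] at hev
        have : (fun y => G y t) =ᶠ[𝓝 a] fun _ => Sum.inl (h ⟨a, ha⟩ t) := by
          filter_upwards [hopen.mem_nhds ha, hev, hD.continuousAt.eventually (gt_mem_nhds hgt)]
            with y hy hye hy'
          rw [hG_ge ⟨y, hy⟩ t (le_of_lt hy'), hye ⟨y, hy⟩ rfl]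
        exact continuousAt_const.congr this.symm

/-- Extend `p` from `X` to `X ⊕ Y`, where each point of `Y` plays the role of a fair random choice
between `x₁` and `x₂`, two such choices being coupled so that they differ with
probability `w`. -/
noncomputable def twoPointExtension {X Y : Type*} (w : Y × Y → ℝ) (x₁ x₂ : X) (p : X × X → ℝ) :
    (X ⊕ Y) × (X ⊕ Y) → ℝ
  | (Sum.inl x, Sum.inl x') => p (x, x')
  | (Sum.inl x, Sum.inr _) => (p (x, x₁) + p (x, x₂)) / 2
  | (Sum.inr _, Sum.inl x) => (p (x₁, x) + p (x₂, x)) / 2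
  | (Sum.inr y, Sum.inr y') => w (y, y') * ((p (x₁, x₂) + p (x₂, x₁)) / 2) +
      (1 - w (y, y')) * ((p (x₁, x₁) + p (x₂, x₂)) / 2)

section twoPointExtension

variable {X Y : Type*} {w : Y × Y → ℝ} {x₁ x₂ : X}

theorem twoPointExtension_linear (p q : X × X → ℝ) (a b : ℝ) (z) :
    twoPointExtension w x₁ x₂ (fun z => a * p z + b * q z) z =
      a * twoPointExtension w x₁ x₂ p z + b * twoPointExtension w x₁ x₂ q z := by
  rcases z with ⟨x | y, x' | y'⟩ <;> simp only [twoPointExtension] <;> ring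

theorem twoPointExtension_const (c : ℝ) (z) :
    twoPointExtension w x₁ x₂ (fun _ => c) z = c := by
  rcases z with ⟨x | y, x' | y'⟩ <;> simp only [twoPointExtension] <;> ring

theorem twoPointExtension_nonneg (hw₀ : ∀ z, 0 ≤ w z) (hw₁ : ∀ z, w z ≤ 1) {p : X × X → ℝ}
    (hp : ∀ z, 0 ≤ p z) (z) : 0 ≤ twoPointExtension w x₁ x₂ p z := by
  rcases z with ⟨x | y, x' | y'⟩
  · exact hp _
  · exact div_nonneg (add_nonneg (hp _) (hp _)) zero_le_two
  · exact div_nonneg (add_nonneg (hp _) (hp _)) zero_le_two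
  · exact add_nonneg
      (mul_nonneg (hw₀ _) (div_nonneg (add_nonneg (hp _) (hp _)) zero_le_two))
      (mul_nonneg (sub_nonneg.2 (hw₁ _)) (div_nonneg (add_nonneg (hp _) (hp _)) zero_le_two))

theorem continuous_twoPointExtension [TopologicalSpace X] [TopologicalSpace Y]
    (hw : Continuous w) {p : X × X → ℝ} (hp : Continuous p) :
    Continuous (twoPointExtension w x₁ x₂ p) := by
  rw [continuous_iff_continuousAt]
  rintro ⟨x | y, x' | y'⟩ <;>
  simp only [ContinuousAt, nhds_prod_eq, nhds_inl, nhds_inr, prod_map_map_eq, tendsto_map'_iff] <;>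
  rw [← nhds_prod_eq]
  · exact hp.continuousAt
  · exact (show Continuous fun z : X × Y => (p (z.1, x₁) + p (z.1, x₂)) / 2 by
      fun_prop).continuousAt
  · exact (show Continuous fun z : Y × X => (p (x₁, z.2) + p (x₂, z.2)) / 2 by
      fun_prop).continuousAt
  · exact (show Continuous fun z : Y × Y => w z * ((p (x₁, x₂) + p (x₂, x₁)) / 2) +
      (1 - w z) * ((p (x₁, x₁) + p (x₂, x₂)) / 2) by fun_prop).continuousAt

theorem IsPseudometric.twoPointExtension (hw : IsPseudometric w) (hw₁ : ∀ z, w z ≤ 1)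
    {p : X × X → ℝ} (hp : IsPseudometric p) :
    IsPseudometric (twoPointExtension w x₁ x₂ p) := by
  obtain ⟨w0, wd, ws, wt⟩ := hw
  obtain ⟨p0, pd, ps, pt⟩ := hp
  have h12 := p0 x₁ x₂
  have key : ∀ y y', w (y, y') * p (x₁, x₂) ≤ p (x₁, x₂) := fun y y' =>
    mul_le_of_le_one_left h12 (hw₁ _)
  have key0 : ∀ y y', 0 ≤ w (y, y') * p (x₁, x₂) := fun y y' => mul_nonneg (w0 _ _) h12
  refine ⟨fun x y => twoPointExtension_nonneg (fun _ => w0 _ _) hw₁ (fun _ => p0 _ _) _,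
    ?_, ?_, ?_⟩
  · rintro (x | y) <;> simp [_root_.twoPointExtension, pd, wd]
  · rintro (x | y) (x' | y') <;> simp only [_root_.twoPointExtension]
    · exact ps _ _
    · rw [ps x x₁, ps x x₂]
    · rw [ps x' x₁, ps x' x₂]
    · rw [ws]
  · rintro (x | y) (x' | y') (x'' | y'') <;> simp only [_root_.twoPointExtension, pd, ps x₂ x₁]
    · exact pt _ _ _
    · linarith [pt x x' x₁, pt x x' x₂]
    · linarith [pt x x₁ x'', pt x x₂ x'']
    · linarith [key0 y' y'']
    · linarith [pt x₁ x' x'', pt x₂ x' x'']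
    · linarith [key y y'', pt x₁ x' x₂, ps x₁ x', ps x₂ x']
    · linarith [key0 y y']
    · linarith [mul_le_mul_of_nonneg_right (wt y y' y'') h12]

end twoPointExtension

theorem exists_regular_extension_operator {Y : Type*} [TopologicalSpace Y]
    [TopologicalSpace.MetrizableSpace Y]
    (X : Set Y) (hX : IsClosed X)
    (x₁ x₂ : Y) (hx₁ : x₁ ∈ X) (hx₂ : x₂ ∈ X) (hne : x₁ ≠ x₂) :
    ∃ T : (↥X × ↥X → ℝ) → (Y × Y → ℝ),
      IsRegularExtensionOperator X T ∧
      (∀ p : ↥X × ↥X → ℝ, ∀ M : ℝ, 0 ≤ M →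
        (∀ z, |p z| ≤ M) → ∀ w, |T p w| ≤ M) ∧
      (∀ p : ↥X × ↥X → ℝ, Continuous p → Continuous (T p)) ∧
      (∀ p : ↥X × ↥X → ℝ, IsPseudometric p → IsPseudometric (T p)) ∧
      (∀ p : ↥X × ↥X → ℝ, IsMetricFun p → IsMetricFun (T p)) := by
  let _ : MetricSpace Y := TopologicalSpace.metrizableSpaceMetric Y
  obtain ⟨G, hG_mem, hG_inr, hG_fin, hG_cont⟩ := exists_random_map hX ⟨x₁, hx₁⟩
  let w : Y × Y → ℝ := fun z => min 1 (dist z.1 z.2)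
  have hw₀ : ∀ z, 0 ≤ w z := fun z => le_min zero_le_one dist_nonneg
  have hw₁ : ∀ z, w z ≤ 1 := fun z => min_le_left _ _
  have hw : IsPseudometric w := by
    refine ⟨fun _ _ => hw₀ _, fun x => by simp [w], fun x y => by simp [w, dist_comm],
      fun x y z => ?_⟩
    rcases min_cases 1 (dist x y) with h | h <;> rcases min_cases 1 (dist y z) with h' | h' <;>
    simp only [w, h.1, h'.1, min_le_iff]
    · left; linarith
    · left; linarith [dist_nonneg (x := y) (y := z)]
    · left; linarith [dist_nonneg (x := x) (y := y)]
    · right; exact dist_triangle _ _ _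
  let E := twoPointExtension w (⟨x₁, hx₁⟩ : ↥X) ⟨x₂, hx₂⟩
  let μ : Measure ℝ := volume.restrict (Ioo 0 1)
  have : IsProbabilityMeasure μ := ⟨by simp [μ]⟩
  let S : (↥X × ↥X → ℝ) → Y × Y → SimpleFunc ℝ ℝ := fun p z => ((G z.1).pair (G z.2)).map (E p)
  have hS : ∀ p z t, S p z t = E p (G z.1 t, G z.2 t) := fun _ _ _ => rfl
  have hint : ∀ p z, Integrable (S p z) μ := fun p z => (S p z).integrable_of_isFiniteMeasure
  let T : (↥X × ↥X → ℝ) → Y × Y → ℝ := fun p z => ∫ t, S p z t ∂μ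
  have hlin : ∀ (p q : ↥X × ↥X → ℝ) (a b : ℝ),
      T (fun z => a * p z + b * q z) = fun w => a * T p w + b * T q w := by
    intro p q a b
    ext z
    simp only [T]
    rw [← integral_const_mul, ← integral_const_mul,
      ← integral_add ((hint p z).const_mul a) ((hint q z).const_mul b)]
    exact integral_congr_ae (Eventually.of_forall fun t => twoPointExtension_linear p q a b _)
  have hpos : ∀ p : ↥X × ↥X → ℝ, (∀ z, 0 ≤ p z) → ∀ w, 0 ≤ T p w := fun p hp z =>
    integral_nonneg fun t => twoPointExtension_nonneg hw₀ hw₁ hp _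
  have hconst : ∀ c : ℝ, T (fun _ => c) = fun _ => c := by
    intro c
    ext z
    simp only [T, hS, E, twoPointExtension_const]
    simp
  have hext : ∀ (p : ↥X × ↥X → ℝ) (x x' : ↥X), T p ((x : Y), (x' : Y)) = p (x, x') := by
    intro p x x'
    simp only [T, hS, hG_mem, E, twoPointExtension]
    simp
  have hpseudo : ∀ p : ↥X × ↥X → ℝ, IsPseudometric p → IsPseudometric (T p) := by
    intro p hp
    obtain ⟨-, hd, hs, ht⟩ : IsPseudometric (E p) := IsPseudometric.twoPointExtension hw hw₁ hp
    refine ⟨fun x y => hpos p (fun _ => hp.1 _ _) _, fun x => ?_, fun x y => ?_, fun x y z => ?_⟩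
    · simp [T, hS, hd]
    · simp only [T, hS]
      exact integral_congr_ae (Eventually.of_forall fun t => hs _ _)
    · simp only [T]
      rw [← integral_add (hint p _) (hint p _)]
      exact integral_mono (hint p _) ((hint p _).add (hint p _)) fun t => ht _ _ _
  refine ⟨T, ⟨hlin, hpos, hconst 1, hext⟩, ?_, ?_, hpseudo, ?_⟩
  · intro p M _ hM z
    have h₁ := hpos (fun z => 1 * M + (-1) * p z) (fun z => by linarith [(abs_le.1 (hM z)).2]) z
    have h₂ := hpos (fun z => 1 * M + 1 * p z) (fun z => by linarith [(abs_le.1 (hM z)).1]) z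
    rw [hlin (fun _ => M) p, hconst] at h₁ h₂
    exact abs_le.2 ⟨by linarith, by linarith⟩
  · intro p hp
    have hE : Continuous (E p) := continuous_twoPointExtension (by fun_prop) hp
    rw [continuous_iff_continuousAt]
    rintro ⟨a, b⟩
    obtain ⟨K, hK, hKt⟩ := hG_fin a
    obtain ⟨L, hL, hLt⟩ := hG_fin b
    obtain ⟨C, hC⟩ := ((hK.prod hL).image fun z => |E p z|).bddAbove
    have hnhds : {z | |E p z| < C + 1} ∈ 𝓝ˢ K ×ˢ 𝓝ˢ L := by
      rw [← hK.isCompact.nhdsSet_prod_eq hL.isCompact]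
      refine (isOpen_lt (by fun_prop) continuous_const).mem_nhdsSet.2 fun z hz => ?_
      exact (hC ⟨z, hz, rfl⟩).trans_lt (lt_add_one C)
    obtain ⟨O, hO, O', hO', hsub⟩ := mem_prod_iff.1 hnhds
    have hOev := eventually_prod_principal_iff.1 (hKt.eventually hO)
    have hOev' := eventually_prod_principal_iff.1 (hLt.eventually hO')
    refine tendsto_integral_filter_of_dominated_convergence (fun _ => C + 1)
      (Eventually.of_forall fun z => (hint p z).aestronglyMeasurable) ?_ (integrable_const _) ?_
    · rw [nhds_prod_eq]
      filter_upwards [hOev.prod_mk hOev'] with z hz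
      refine (ae_restrict_iff' measurableSet_Ioo).2 (Eventually.of_forall fun t ht => ?_)
      exact (show |E p (G z.1 t, G z.2 t)| < C + 1 from
        hsub (mk_mem_prod (hz.1 t ht) (hz.2 t ht))).le
    · refine (ae_restrict_iff' measurableSet_Ioo).2 ?_
      filter_upwards [hG_cont a, hG_cont b] with t hta htb ht
      have hpair : ContinuousAt (fun z : Y × Y => (G z.1 t, G z.2 t)) (a, b) :=
        ContinuousAt.prodMk
          (ContinuousAt.comp (f := Prod.fst) (x := (a, b)) (hta ht) continuousAt_fst)
          (ContinuousAt.comp (f := Prod.snd) (x := (a, b)) (htb ht) continuousAt_snd)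
      exact (hE.tendsto _).comp hpair
  · rintro p ⟨hp, hsep⟩
    refine ⟨hpseudo p hp, fun y y' h => ?_⟩
    have hS₀ : ∀ t, 0 ≤ S p (y, y') t := fun t =>
      twoPointExtension_nonneg hw₀ hw₁ (p := p) (fun _ => hp.1 _ _) _
    have hae : ∀ᵐ t ∂μ, S p (y, y') t = 0 :=
      (integral_eq_zero_iff_of_nonneg hS₀ (hint p _)).1 h
    have hzero : ∀ ε > 0, ∃ t < ε, E p (G y t, G y' t) = 0 := by
      intro ε hε
      have hvol : volume (Ioo 0 (min ε 1)) ≠ 0 := by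
        simp [hε]
      obtain ⟨t, ht, h0⟩ := (frequently_ae_mem_iff.2 hvol).and_eventually
        ((ae_restrict_iff' measurableSet_Ioo).1 hae) |>.exists
      exact ⟨t, ht.2.trans_le (min_le_left _ _), h0 ⟨ht.1, ht.2.trans_le (min_le_right _ _)⟩⟩
    have h12 : 0 < p (⟨x₁, hx₁⟩, ⟨x₂, hx₂⟩) :=
      (hp.1 _ _).lt_of_ne fun h0 => hne (congrArg Subtype.val (hsep _ _ h0.symm))
    have htri : ∀ x : ↥X, 0 < p (⟨x₁, hx₁⟩, x) + p (⟨x₂, hx₂⟩, x) := fun x => by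
      linarith [hp.2.2.2 ⟨x₁, hx₁⟩ x ⟨x₂, hx₂⟩, hp.2.2.1 x ⟨x₂, hx₂⟩]
    by_cases hy : y ∈ X <;> by_cases hy' : y' ∈ X
    · rw [hext p ⟨y, hy⟩ ⟨y', hy'⟩] at h
      exact congrArg Subtype.val (hsep _ _ h)
    · obtain ⟨ε, hε, hlt⟩ := hG_inr y' hy'
      obtain ⟨t, ht, h0⟩ := hzero ε hε
      rw [hlt t ht, hG_mem ⟨y, hy⟩] at h0
      simp only [E, twoPointExtension] at h0
      rw [hp.2.2.1 _ ⟨x₁, hx₁⟩, hp.2.2.1 _ ⟨x₂, hx₂⟩] at h0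
      linarith [htri ⟨y, hy⟩]
    · obtain ⟨ε, hε, hlt⟩ := hG_inr y hy
      obtain ⟨t, ht, h0⟩ := hzero ε hε
      rw [hlt t ht, hG_mem ⟨y', hy'⟩] at h0
      simp only [E, twoPointExtension] at h0
      linarith [htri ⟨y', hy'⟩]
    · obtain ⟨ε, hε, hlt⟩ := hG_inr y hy
      obtain ⟨ε', hε', hlt'⟩ := hG_inr y' hy'
      obtain ⟨t, ht, h0⟩ := hzero (min ε ε') (lt_min hε hε')
      rw [hlt t (ht.trans_le (min_le_left _ _)), hlt' t (ht.trans_le (min_le_right _ _))] at h0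
      simp only [E, twoPointExtension, hp.2.1, hp.2.2.1 ⟨x₂, hx₂⟩ ⟨x₁, hx₁⟩] at h0
      have hw0 : w (y, y') = 0 := by
        have : w (y, y') * p (⟨x₁, hx₁⟩, ⟨x₂, hx₂⟩) = 0 := by linarith
        exact (mul_eq_zero.1 this).resolve_right h12.ne'
      by_contra hyy
      exact (lt_min one_pos (dist_pos.2 hyy)).ne' hw0
end

section
/- Let Y be a metrizable topological space and X ⊆ Y a closed subset containing at least two points, equipped with the subspace topology. Then there exists a regular extension operator T : (X × X → ℝ) → (Y × Y → ℝ) which maps continuous functions to continuous functions, pseudometrics on X to pseudometrics on Y, metrics on X to metrics on Y, and admissible metrics on X to admissible metrics on Y. -/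
/-- A metric on a topological space is admissible if it is continuous and its
open balls form neighborhood bases (i.e. it induces the topology). -/
def IsAdmissible {Z : Type*} [TopologicalSpace Z] (d : Z × Z → ℝ) : Prop :=
  Continuous d ∧
  ∀ z : Z, ∀ U ∈ nhds z, ∃ ε : ℝ, 0 < ε ∧ {z' : Z | d (z, z') < ε} ⊆ U

open Set Filter Topology MeasureTheory ProbabilityTheory

/-- The uniform distribution on the open unit interval, as a measure on `ℝ`. -/
noncomputable def unitUniform : Measure ℝ := volume.restrict (Ioo 0 1)

instance : IsProbabilityMeasure unitUniform :=
  ⟨by simp [unitUniform]⟩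

theorem unitUniform_Iio {a : ℝ} (h1 : a ≤ 1) :
    unitUniform (Iio a) = ENNReal.ofReal a := by
  rw [unitUniform, Measure.restrict_apply measurableSet_Iio, Iio_inter_Ioo, min_eq_left h1]
  simp

theorem unitUniform_Ici {a : ℝ} (h0 : 0 < a) :
    unitUniform (Ici a) = ENNReal.ofReal (1 - a) := by
  rw [unitUniform, Measure.restrict_apply measurableSet_Ici]
  have : Ici a ∩ Ioo 0 1 = Ico a 1 := by
    ext t
    simp only [mem_inter_iff, mem_Ici, mem_Ioo, mem_Ico]
    exact ⟨fun h => ⟨h.1, h.2.2⟩, fun h => ⟨h.1, h0.trans_le h.1, h.2⟩⟩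
  simp [this]

section ExpectationOperator

variable {Y Ω : Type*} [MeasurableSpace Ω] {X : Set Y}

/-- The operator sending `p` to the expected value of `p` along a random pair of points of `X`. -/
noncomputable def expectationOperator (μ : Measure Ω) (ξ : Y → SimpleFunc Ω X)
    (p : X × X → ℝ) (w : Y × Y) : ℝ :=
  ∫ ω, p (ξ w.1 ω, ξ w.2 ω) ∂μ

theorem integrable_simpleFunc_pair (μ : Measure Ω) [IsFiniteMeasure μ] {A B : Type*}
    (f : SimpleFunc Ω A) (g : SimpleFunc Ω B) (p : A × B → ℝ) :
    Integrable (fun ω => p (f ω, g ω)) μ :=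
  ((f.pair g).map p).integrable_of_isFiniteMeasure

variable (μ : Measure Ω) [IsProbabilityMeasure μ] (ξ : Y → SimpleFunc Ω X)

theorem isRegularExtensionOperator_expectationOperator (hξ : ∀ (x : X) ω, ξ x ω = x) :
    IsRegularExtensionOperator X (expectationOperator μ ξ) := by
  refine ⟨fun p q a b => ?_, fun p hp w => integral_nonneg fun ω => hp _, ?_, fun p x x' => ?_⟩
  · funext w
    have hp := integrable_simpleFunc_pair μ (ξ w.1) (ξ w.2) p
    have hq := integrable_simpleFunc_pair μ (ξ w.1) (ξ w.2) q
    simp only [expectationOperator]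
    rw [integral_add (hp.const_mul a) (hq.const_mul b), integral_const_mul, integral_const_mul]
  · funext w
    simp [expectationOperator]
  · simp [expectationOperator, hξ]

theorem IsPseudometric.expectationOperator {p : X × X → ℝ} (hp : IsPseudometric p) :
    IsPseudometric (expectationOperator μ ξ p) := by
  obtain ⟨h0, hd, hs, ht⟩ := hp
  refine ⟨fun x y => integral_nonneg fun ω => h0 _ _,
    fun x => by simp [_root_.expectationOperator, hd],
    fun x y => by simp only [_root_.expectationOperator, hs (ξ x _)], fun x y z => ?_⟩
  have hxy := integrable_simpleFunc_pair μ (ξ x) (ξ y) p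
  have hyz := integrable_simpleFunc_pair μ (ξ y) (ξ z) p
  simp only [_root_.expectationOperator]
  rw [← integral_add hxy hyz]
  exact integral_mono (integrable_simpleFunc_pair μ (ξ x) (ξ z) p) (hxy.add hyz)
    fun ω => ht _ _ _

variable [TopologicalSpace Y]

theorem continuous_expectationOperator [FirstCountableTopology Y]
    (hae : ∀ y, ∀ᵐ ω ∂μ, Tendsto (fun w => ξ w ω) (𝓝 y) (𝓝 (ξ y ω)))
    (hK : ∀ y, ∃ K : Set X, IsCompact K ∧ ∀ W, IsOpen W → K ⊆ W → ∀ᶠ w in 𝓝 y, ∀ ω, ξ w ω ∈ W)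
    {p : X × X → ℝ} (hp : Continuous p) : Continuous (expectationOperator μ ξ p) := by
  rw [continuous_iff_continuousAt]
  rintro ⟨y, z⟩
  obtain ⟨K, hKc, hK'⟩ := hK y
  obtain ⟨L, hLc, hL'⟩ := hK z
  obtain ⟨M, hM⟩ := (hKc.prod hLc).exists_bound_of_continuousOn hp.continuousOn
  obtain ⟨U, V, hU, hV, hKU, hLV, hUV⟩ := generalized_tube_lemma hKc hLc
    (isOpen_lt hp.norm (continuous_const (y := M + 1)))
    (fun q hq => (hM q hq).trans_lt (lt_add_one M))
  refine continuousAt_of_dominated (bound := fun _ => M + 1)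
    (.of_forall fun w => (integrable_simpleFunc_pair μ (ξ w.1) (ξ w.2) p).aestronglyMeasurable)
    ?_ (integrable_const _) ?_
  · rw [nhds_prod_eq]
    filter_upwards [(hK' U hU hKU).prod_mk (hL' V hV hLV)] with w hw
    exact .of_forall fun ω => (hUV (mk_mem_prod (hw.1 ω) (hw.2 ω))).le
  · filter_upwards [hae y, hae z] with ω hy hz
    refine (hp.tendsto _).comp ?_
    rw [nhds_prod_eq, nhds_prod_eq]
    exact hy.prodMap hz

end ExpectationOperator

/-- A metric space admits random labels, in which a point is labelled by a nearby point, the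
labels near a given point range over a finite set and are almost surely locally constant. -/
theorem exists_random_label {S : Type*} [MetricSpace S] (r : S → ℝ) (hr : ∀ i, 0 < r i) :
    ∃ ζ : S → SimpleFunc ℝ S,
      (∀ z t, dist z (ζ z t) < r (ζ z t)) ∧
      (∀ z, ∃ J : Finset S, ∀ᶠ w in 𝓝 z, ∀ t, ζ w t ∈ J) ∧
      (∀ z, ∀ᵐ t ∂unitUniform, ∀ᶠ w in 𝓝 z, ζ w t = ζ z t) := by
  classical
  rcases isEmpty_or_nonempty S with hS | hS
  · exact ⟨isEmptyElim, isEmptyElim, isEmptyElim, isEmptyElim⟩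
  obtain ⟨f, hf⟩ := BumpCovering.exists_isSubordinate (s := (univ : Set S)) isClosed_univ
    (fun i => Metric.ball i (r i)) (fun i => Metric.isOpen_ball)
    (fun z _ => mem_iUnion.2 ⟨z, Metric.mem_ball_self (hr z)⟩)
  let c : ℝ → ℝ := fun t => if t ∈ Ioo (0 : ℝ) 1 then t else 1 / 2
  have hcm : Measurable c := measurable_id.ite measurableSet_Ioo measurable_const
  have hc : ∀ t, c t ∈ Ioo (0 : ℝ) 1 := fun t => by
    by_cases h : t ∈ Ioo (0 : ℝ) 1
    · simpa only [c, if_pos h] using h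
    · simp only [c, if_neg h]; norm_num
  have hsupp : ∀ z t i, c t < f i z → i ∈ Function.support fun i => f i z := fun z t i h =>
    ((hc t).1.trans h).ne'
  choose J hJ using fun z => f.locallyFinite.exists_finset_support z
  have hJz : ∀ z t, {i | c t < f i z} ⊆ J z := fun z t i h =>
    (hJ z).self_of_nhds (hsupp z t i h)
  let A : S → SimpleFunc ℝ (Set S) := fun z =>
    { toFun := fun t => {i | c t < f i z}
      measurableSet_fiber' := fun B => by
        by_cases hB : B ⊆ J z
        · have : (fun t => {i | c t < f i z}) ⁻¹' {B} =
              ⋂ i ∈ J z, {t | c t < f i z ↔ i ∈ B} := by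
            ext t
            simp only [mem_preimage, mem_singleton_iff, mem_iInter, mem_ofPred_eq]
            refine ⟨fun h i _ => by rw [← h]; rfl, fun h => ?_⟩
            ext i
            exact ⟨fun hi => (h i (hJz z t hi)).1 hi, fun hi => (h i (hB hi)).2 hi⟩
          rw [this]
          refine (J z).measurableSet_biInter fun i _ => ?_
          exact (measurableSet_lt hcm measurable_const).iff (.const _)
        · convert MeasurableSet.empty
          refine eq_empty_of_forall_notMem fun t ht => hB ?_
          rw [← show _ = B from ht]
          exact hJz z t
      finite_range' := (J z).finite_toSet.finite_subsets.subset (by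
        rintro _ ⟨t, rfl⟩
        exact hJz z t) }
  let g : Set S → S := fun B => Classical.epsilon (· ∈ B)
  have hg : ∀ z t, c t < f (g (A z t)) z := fun z t => by
    have : ∃ i, i ∈ A z t := ⟨f.ind z trivial, by
      change c t < f _ z
      rw [f.ind_apply z trivial]; exact (hc t).2⟩
    exact Classical.epsilon_spec this
  refine ⟨fun z => (A z).map g, fun z t => ?_, fun z => ⟨J z, ?_⟩, fun z => ?_⟩
  · exact hf _ (subset_tsupport _ (hsupp z t _ (hg z t)))
  · filter_upwards [hJ z] with w hw t
    exact hw (hsupp w t _ (hg w t))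
  · have hfin : ((J z).image fun i => f i z : Set ℝ).Finite := Finset.finite_toSet _
    filter_upwards [ae_restrict_of_ae (hfin.countable.ae_notMem volume),
      ae_restrict_mem measurableSet_Ioo] with t ht ht1
    have hct : c t = t := if_pos ht1
    have hloc : ∀ i ∈ J z, ∀ᶠ w in 𝓝 z, (c t < f i w ↔ c t < f i z) := fun i hi => by
      have hne : t ≠ f i z := fun h => ht (by simpa using ⟨i, hi, h.symm⟩)
      rw [hct]
      rcases hne.lt_or_gt with h | h
      · filter_upwards [(f i).continuous.continuousAt.eventually_const_lt h] with w hw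
        exact iff_of_true hw h
      · filter_upwards [(f i).continuous.continuousAt.eventually_lt_const h] with w hw
        exact iff_of_false hw.not_gt h.not_gt
    filter_upwards [(J z).eventually_all.2 hloc, hJ z] with w hw hw'
    refine congrArg g (Set.ext fun i => ?_)
    by_cases hi : i ∈ J z
    · exact hw i hi
    · exact iff_of_false (fun h => hi (hw' (hsupp w t i h))) (fun h => hi (hJz z t h))

section Coding

variable {S : Type*}

/-- The distribution of a family of independent uniform random variables on the unit interval. -/
noncomputable def coinMeasure (S : Type*) : Measure (S → ℝ) :=
  Measure.infinitePi fun _ => unitUniform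

instance : IsProbabilityMeasure (coinMeasure S) := by
  unfold coinMeasure; infer_instance

/-- The random point that equals `x₁` or `x₂` with probability `1 / 2`, as decided by the coin
with index `i`. -/
noncomputable def coinFlip {A : Type*} (x₁ x₂ : A) (i : S) : SimpleFunc (S → ℝ) A :=
  .piecewise {B | B i < 1 / 2} (measurableSet_lt (measurable_pi_apply i) measurable_const)
    (.const _ x₁) (.const _ x₂)

theorem coinMeasure_real_lt (i : S) : (coinMeasure S).real {B | B i < 1 / 2} = 1 / 2 := by
  have h := (measurePreserving_eval_infinitePi (fun _ : S => unitUniform) i).measureReal_preimage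
    (s := Iio (1 / 2)) measurableSet_Iio.nullMeasurableSet
  refine h.trans ?_
  rw [measureReal_def, unitUniform_Iio (by norm_num), ENNReal.toReal_ofReal (by norm_num)]

theorem coinMeasure_real_lt_inter_ge {i j : S} (hij : i ≠ j) :
    (coinMeasure S).real {B | B i < 1 / 2 ∧ 1 / 2 ≤ B j} = 1 / 4 := by
  classical
  have h : {B : S → ℝ | B i < 1 / 2 ∧ 1 / 2 ≤ B j} =
      Set.pi (({i, j} : Finset S) : Set S) fun k => if k = i then Iio (1 / 2) else Ici (1 / 2) := by
    ext B
    simp [hij.symm]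
  rw [measureReal_def, h, coinMeasure, Measure.infinitePi_pi, Finset.prod_pair hij, if_pos rfl,
    if_neg hij.symm, unitUniform_Iio (by norm_num), unitUniform_Ici (by norm_num),
    ENNReal.toReal_mul, ENNReal.toReal_ofReal (by norm_num), ENNReal.toReal_ofReal (by norm_num)]
  · norm_num
  · intro k _
    split_ifs
    exacts [measurableSet_Iio, measurableSet_Ici]

variable {A : Type*} {p : A × A → ℝ} (hp : IsPseudometric p)
include hp

theorem le_integral_coinFlip_const (x₁ x₂ b : A) (i : S) :
    p (x₁, x₂) / 4 ≤ ∫ B, p (coinFlip x₁ x₂ i B, b) ∂coinMeasure S := by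
  obtain ⟨h0, -, hs, ht⟩ := hp
  set P : Set (S → ℝ) := {B | B i < 1 / 2}
  have hP : MeasurableSet P := measurableSet_lt (measurable_pi_apply i) measurable_const
  have heq : (fun B => p (coinFlip x₁ x₂ i B, b)) = fun B =>
      P.indicator (fun _ => p (x₁, b)) B + Pᶜ.indicator (fun _ => p (x₂, b)) B := by
    funext B
    by_cases hB : B ∈ P
    · rw [coinFlip, SimpleFunc.piecewise_apply, if_pos hB]
      simp [hB]
    · rw [coinFlip, SimpleFunc.piecewise_apply, if_neg hB]
      simp [hB]
  rw [heq, integral_add ((integrable_const _).indicator hP)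
    ((integrable_const _).indicator hP.compl), integral_indicator_const _ hP,
    integral_indicator_const _ hP.compl, probReal_compl_eq_one_sub hP, coinMeasure_real_lt]
  have h1 := ht x₁ b x₂
  have h2 := h0 x₁ x₂
  rw [hs b x₂] at h1
  simp only [smul_eq_mul]
  linarith

theorem le_integral_coinFlip_coinFlip (x₁ x₂ : A) {i j : S} (hij : i ≠ j) :
    p (x₁, x₂) / 4 ≤ ∫ B, p (coinFlip x₁ x₂ i B, coinFlip x₁ x₂ j B) ∂coinMeasure S := by
  set E : Set (S → ℝ) := {B | B i < 1 / 2 ∧ 1 / 2 ≤ B j}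
  have hE : MeasurableSet E := (measurableSet_lt (measurable_pi_apply i) measurable_const).inter
    (measurableSet_le measurable_const (measurable_pi_apply j))
  have h : ∫ B, E.indicator (fun _ => p (x₁, x₂)) B ∂coinMeasure S = p (x₁, x₂) / 4 := by
    rw [integral_indicator_const _ hE, coinMeasure_real_lt_inter_ge hij, smul_eq_mul]
    ring
  rw [← h]
  refine integral_mono ((integrable_const _).indicator hE)
    (integrable_simpleFunc_pair _ (coinFlip x₁ x₂ i) (coinFlip x₁ x₂ j) p) fun B => ?_
  refine indicator_le_self' (s := E) (f := fun B => p (coinFlip x₁ x₂ i B, coinFlip x₁ x₂ j B))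
    (fun _ _ => hp.1 _ _) B |>.trans' (le_of_eq ?_)
  by_cases hB : B ∈ E
  · rw [indicator_of_mem hB, indicator_of_mem hB, coinFlip, coinFlip, SimpleFunc.piecewise_apply,
      SimpleFunc.piecewise_apply, if_pos (show B ∈ {B : S → ℝ | B i < 1 / 2} from hB.1),
      if_neg (show B ∉ {B : S → ℝ | B j < 1 / 2} from hB.2.not_gt)]
    rfl
  · rw [indicator_of_notMem hB, indicator_of_notMem hB]

end Coding

section RandomPoint

variable {Y : Type*} [MetricSpace Y] {X : Set Y}

/-- The probability measure governing a uniform parameter, a random scale and a family of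
independent coins indexed by `S`. -/
noncomputable def labelMeasure (S : Type*) : Measure ((ℝ × ℕ) × (S → ℝ)) :=
  (unitUniform.prod (poissonMeasure 1)).prod (coinMeasure S)

instance {S : Type*} : IsProbabilityMeasure (labelMeasure S) := by
  unfold labelMeasure; infer_instance

theorem ae_labelMeasure {S : Type*} {P : ℝ → Prop} (h : ∀ᵐ t ∂unitUniform, P t) :
    ∀ᵐ ω ∂labelMeasure S, P ω.1.1 :=
  (Measure.quasiMeasurePreserving_fst.comp Measure.quasiMeasurePreserving_fst).ae h

theorem measurableSet_coin_label {S : Type*} (ζ : ℕ → SimpleFunc ℝ S) :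
    MeasurableSet {ω : (ℝ × ℕ) × (S → ℝ) | ω.2 (ζ ω.1.2 ω.1.1) < 1 / 2} := by
  have h : {ω : (ℝ × ℕ) × (S → ℝ) | ω.2 (ζ ω.1.2 ω.1.1) < 1 / 2} =
      ⋃ n : ℕ, ⋃ i ∈ (ζ n).range,
        (((ζ n ⁻¹' {i}) ×ˢ {n}) ×ˢ {B : S → ℝ | B i < 1 / 2}) := by
    ext ⟨⟨t, n⟩, B⟩
    simp only [mem_ofPred_eq, mem_iUnion, mem_prod, mem_preimage, mem_singleton_iff]
    constructor
    · exact fun h => ⟨n, _, (ζ n).mem_range_self t, ⟨rfl, rfl⟩, h⟩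
    · rintro ⟨_, _, _, ⟨rfl, rfl⟩, h⟩
      exact h
  rw [h]
  exact .iUnion fun n => Finset.measurableSet_biUnion _ fun i _ =>
    (((ζ n).measurableSet_fiber i).prod (measurableSet_singleton n)).prod
      (measurableSet_lt (measurable_pi_apply i) measurable_const)

/-- The probability that the random point associated with `y` is chosen by a coin. -/
noncomputable def codingWeight (X : Set Y) (y : Y) : ℝ := min (Metric.infDist y X) (1 / 2)

theorem continuous_codingWeight (X : Set Y) : Continuous (codingWeight X) :=
  (Metric.continuous_infDist_pt X).min continuous_const

open Classical in
/-- The random point of `X` associated with `y : Y`. It is `y` itself if `y ∈ X`. Otherwise, with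
probability `codingWeight X y` it is one of `x₁`, `x₂`, as decided by the coin of the label
of `y` at a random scale, and it is a point of `X` close to `y` in the remaining cases. -/
noncomputable def randomPoint (x₁ x₂ : X) (a : ↥Xᶜ → X) (ζ : ℕ → ↥Xᶜ → SimpleFunc ℝ ↥Xᶜ) (y : Y) :
    SimpleFunc ((ℝ × ℕ) × (↥Xᶜ → ℝ)) X :=
  if h : y ∈ X then .const _ ⟨y, h⟩ else
    .piecewise {ω | ω.1.1 < codingWeight X y}
      (measurableSet_lt (measurable_fst.comp measurable_fst) measurable_const)
      (.piecewise _ (measurableSet_coin_label fun n => ζ n ⟨y, h⟩) (.const _ x₁) (.const _ x₂))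
      (((ζ 0 ⟨y, h⟩).map a).comp (fun ω => ω.1.1) (measurable_fst.comp measurable_fst))

variable (x₁ x₂ : X) (a : ↥Xᶜ → X) (ζ : ℕ → ↥Xᶜ → SimpleFunc ℝ ↥Xᶜ)

theorem randomPoint_coe (x : X) (ω : (ℝ × ℕ) × (↥Xᶜ → ℝ)) :
    randomPoint x₁ x₂ a ζ x ω = x := by
  simp [randomPoint]

theorem randomPoint_of_lt (y : ↥Xᶜ) {ω : (ℝ × ℕ) × (↥Xᶜ → ℝ)} (h : ω.1.1 < codingWeight X y) :
    randomPoint x₁ x₂ a ζ y ω = coinFlip x₁ x₂ (ζ ω.1.2 y ω.1.1) ω.2 := by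
  rw [randomPoint, dif_neg y.2, SimpleFunc.piecewise_apply,
    if_pos (show ω ∈ {ω | ω.1.1 < codingWeight X y} from h)]
  rfl

theorem randomPoint_of_ge (y : ↥Xᶜ) {ω : (ℝ × ℕ) × (↥Xᶜ → ℝ)} (h : codingWeight X y ≤ ω.1.1) :
    randomPoint x₁ x₂ a ζ y ω = a (ζ 0 y ω.1.1) := by
  rw [randomPoint, dif_neg y.2, SimpleFunc.piecewise_apply,
    if_neg (show ω ∉ {ω | ω.1.1 < codingWeight X y} from h.not_gt)]
  rfl

theorem coinFlip_eq_or {S A : Type*} (x₁ x₂ : A) (i : S) (B : S → ℝ) :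
    coinFlip x₁ x₂ i B = x₁ ∨ coinFlip x₁ x₂ i B = x₂ :=
  ite_eq_or_eq _ _ _

/-- Points in different labels at scale `n` have random points at positive expected distance. -/
theorem le_expectationOperator_randomPoint {p : X × X → ℝ} (hp : IsPseudometric p) (y : ↥Xᶜ)
    (w : Y) (n : ℕ) (hw : ∀ h : w ∈ Xᶜ, ∀ t, ζ n y t ≠ ζ n ⟨w, h⟩ t) :
    codingWeight X y * (poissonMeasure 1).real {n} * (p (x₁, x₂) / 4) ≤
      expectationOperator (labelMeasure ↥Xᶜ) (randomPoint x₁ x₂ a ζ) p (y, w) := by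
  have hint := integrable_simpleFunc_pair (labelMeasure ↥Xᶜ) (randomPoint x₁ x₂ a ζ y)
    (randomPoint x₁ x₂ a ζ w) p
  have hreg : MeasurableSet (Iio (codingWeight X y) ×ˢ {n} : Set (ℝ × ℕ)) :=
    measurableSet_Iio.prod (measurableSet_singleton n)
  have hs0 : 0 ≤ codingWeight X y := le_min Metric.infDist_nonneg (by norm_num)
  have hs1 : codingWeight X y ≤ 1 := (min_le_right _ _).trans (by norm_num)
  rw [expectationOperator, labelMeasure, integral_prod _ hint]
  have h : ∫ q, (Iio (codingWeight X y) ×ˢ {n} : Set (ℝ × ℕ)).indicator (fun _ => p (x₁, x₂) / 4) q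
      ∂unitUniform.prod (poissonMeasure 1) =
      codingWeight X y * (poissonMeasure 1).real {n} * (p (x₁, x₂) / 4) := by
    rw [integral_indicator_const _ hreg, measureReal_prod_prod, smul_eq_mul,
      measureReal_def unitUniform, unitUniform_Iio hs1, ENNReal.toReal_ofReal hs0]
  rw [← h]
  refine integral_mono ((integrable_const _).indicator hreg) hint.integral_prod_left ?_
  rintro ⟨t, m⟩
  by_cases hq : (t, m) ∈ (Iio (codingWeight X y) ×ˢ {n} : Set (ℝ × ℕ))
  · have ht : t < codingWeight X y := hq.1
    have hm : m = n := hq.2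
    rw [indicator_of_mem hq]
    simp only [randomPoint_of_lt x₁ x₂ a ζ y
      (show ((t, m), (_ : ↥Xᶜ → ℝ)).1.1 < codingWeight X y from ht)]
    by_cases hwX : w ∈ X
    · simp only [randomPoint_coe x₁ x₂ a ζ ⟨w, hwX⟩]
      exact le_integral_coinFlip_const hp _ _ _ _
    · rcases lt_or_ge t (codingWeight X w) with htw | htw
      · simp only [randomPoint_of_lt x₁ x₂ a ζ ⟨w, hwX⟩
          (show ((t, m), (_ : ↥Xᶜ → ℝ)).1.1 < codingWeight X w from htw)]
        exact le_integral_coinFlip_coinFlip hp _ _ (hm ▸ hw hwX t)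
      · simp only [randomPoint_of_ge x₁ x₂ a ζ ⟨w, hwX⟩
          (show codingWeight X w ≤ ((t, m), (_ : ↥Xᶜ → ℝ)).1.1 from htw)]
        exact le_integral_coinFlip_const hp _ _ _ _
  · rw [indicator_of_notMem hq]
    exact integral_nonneg fun _ => hp.1 _ _

variable {a ζ}

theorem dist_randomPoint_mem_le (y : Y) {x : X} {ω : (ℝ × ℕ) × (↥Xᶜ → ℝ)}
    (h : dist y (randomPoint x₁ x₂ a ζ y ω) ≤ 4 * Metric.infDist y X) :
    dist (randomPoint x₁ x₂ a ζ y ω) x ≤ 5 * dist y x := by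
  have h1 := Metric.infDist_le_dist_of_mem (x := y) x.2
  have h2 := dist_triangle_left (randomPoint x₁ x₂ a ζ y ω : Y) x y
  rw [Subtype.dist_eq]
  linarith

variable (ha : ∀ (z : ↥Xᶜ) t, dist (z : Y) (a (ζ 0 z t)) ≤ 4 * Metric.infDist (z : Y) X)
include ha

theorem dist_randomPoint_le (y : Y) {ω : (ℝ × ℕ) × (↥Xᶜ → ℝ)} (h : codingWeight X y ≤ ω.1.1) :
    dist y (randomPoint x₁ x₂ a ζ y ω) ≤ 4 * Metric.infDist y X := by
  by_cases hy : y ∈ X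
  · rw [randomPoint_coe x₁ x₂ a ζ ⟨y, hy⟩, dist_self]
    exact mul_nonneg (by norm_num) Metric.infDist_nonneg
  · rw [randomPoint_of_ge x₁ x₂ a ζ ⟨y, hy⟩ h]
    exact ha ⟨y, hy⟩ _

theorem randomPoint_eq_or_dist_le (y : Y) (ω : (ℝ × ℕ) × (↥Xᶜ → ℝ)) :
    randomPoint x₁ x₂ a ζ y ω = x₁ ∨ randomPoint x₁ x₂ a ζ y ω = x₂ ∨
      dist y (randomPoint x₁ x₂ a ζ y ω) ≤ 4 * Metric.infDist y X := by
  rcases le_or_gt (codingWeight X y) ω.1.1 with h | h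
  · exact .inr (.inr (dist_randomPoint_le x₁ x₂ ha y h))
  · by_cases hy : y ∈ X
    · right; right
      rw [randomPoint_coe x₁ x₂ a ζ ⟨y, hy⟩, dist_self]
      exact mul_nonneg (by norm_num) Metric.infDist_nonneg
    · rw [randomPoint_of_lt x₁ x₂ a ζ ⟨y, hy⟩ h]
      exact (coinFlip_eq_or _ _ _ _).imp_right .inl

theorem exists_compact_randomPoint (hX : IsClosed X)
    (hJ : ∀ z, ∃ J : Finset ↥Xᶜ, ∀ᶠ w in 𝓝 z, ∀ t, ζ 0 w t ∈ J) (y : Y) :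
    ∃ K : Set X, IsCompact K ∧ ∀ W, IsOpen W → K ⊆ W →
      ∀ᶠ w in 𝓝 y, ∀ ω, randomPoint x₁ x₂ a ζ w ω ∈ W := by
  by_cases hy : y ∈ X
  · refine ⟨{x₁, x₂, ⟨y, hy⟩}, (toFinite _).isCompact, fun W hW hKW => ?_⟩
    obtain ⟨ε, hε, hεW⟩ := Metric.isOpen_iff.1 hW ⟨y, hy⟩ (hKW (by simp))
    filter_upwards [Metric.ball_mem_nhds y (show 0 < ε / 5 by positivity)] with w hw ω
    rcases randomPoint_eq_or_dist_le x₁ x₂ ha w ω with h | h | h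
    · rw [h]; exact hKW (by simp)
    · rw [h]; exact hKW (by simp)
    · refine hεW ((dist_randomPoint_mem_le x₁ x₂ w h).trans_lt ?_)
      rw [Metric.mem_ball] at hw
      change 5 * dist w y < ε
      linarith
  · obtain ⟨J, hJ⟩ := hJ ⟨y, hy⟩
    refine ⟨{x₁, x₂} ∪ a '' J, ((toFinite _).union (J.finite_toSet.image a)).isCompact,
      fun W _ hKW => ?_⟩
    rw [← show map Subtype.val (𝓝 (⟨y, hy⟩ : ↥Xᶜ)) = 𝓝 y from
      hX.isOpen_compl.isOpenEmbedding_subtypeVal.map_nhds_eq _, eventually_map]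
    filter_upwards [hJ] with w hw ω
    rcases lt_or_ge ω.1.1 (codingWeight X w) with h | h
    · rw [randomPoint_of_lt x₁ x₂ a ζ w h]
      refine hKW (.inl ?_)
      exact coinFlip_eq_or _ _ _ _
    · rw [randomPoint_of_ge x₁ x₂ a ζ w h]
      exact hKW (.inr (mem_image_of_mem a (hw _)))

theorem ae_tendsto_randomPoint (hX : IsClosed X)
    (hζ : ∀ n z, ∀ᵐ t ∂unitUniform, ∀ᶠ w in 𝓝 z, ζ n w t = ζ n z t) (y : Y) :
    ∀ᵐ ω ∂labelMeasure ↥Xᶜ,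
      Tendsto (fun w => randomPoint x₁ x₂ a ζ w ω) (𝓝 y) (𝓝 (randomPoint x₁ x₂ a ζ y ω)) := by
  by_cases hy : y ∈ X
  · have hpos : ∀ᵐ t ∂unitUniform, 0 < t := by
      filter_upwards [ae_restrict_mem measurableSet_Ioo] with t ht using ht.1
    filter_upwards [ae_labelMeasure hpos] with ω hω
    rw [randomPoint_coe x₁ x₂ a ζ ⟨y, hy⟩]
    have h0 : codingWeight X y < ω.1.1 := by
      rw [codingWeight, Metric.infDist_zero_of_mem hy]
      exact (min_le_left _ _).trans_lt hω
    rw [tendsto_iff_dist_tendsto_zero]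
    have hlim : Tendsto (fun w => 5 * dist w y) (𝓝 y) (𝓝 0) := by
      simpa using (tendsto_iff_dist_tendsto_zero.1 (tendsto_id (x := 𝓝 y))).const_mul 5
    refine squeeze_zero' (.of_forall fun _ => dist_nonneg) ?_ hlim
    filter_upwards [(continuous_codingWeight X).continuousAt.eventually_lt_const h0] with w hw
    exact dist_randomPoint_mem_le x₁ x₂ w (dist_randomPoint_le x₁ x₂ ha w hw.le)
  · have hne : ∀ᵐ t ∂unitUniform, t ≠ codingWeight X y :=
      ae_restrict_of_ae (Measure.ae_ne volume _)
    filter_upwards [ae_labelMeasure hne,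
      ae_labelMeasure (ae_all_iff.2 fun n => hζ n ⟨y, hy⟩)] with ω hω hζω
    refine tendsto_nhds_of_eventually_eq ?_
    have hs := (continuous_codingWeight X).continuousAt (x := y)
    rcases hω.lt_or_gt with h | h
    · have hs' := hs.eventually_const_lt h
      rw [← show map Subtype.val (𝓝 (⟨y, hy⟩ : ↥Xᶜ)) = 𝓝 y from
        hX.isOpen_compl.isOpenEmbedding_subtypeVal.map_nhds_eq _, eventually_map] at hs' ⊢
      filter_upwards [hζω ω.1.2, hs'] with w hw hw'
      rw [randomPoint_of_lt x₁ x₂ a ζ w hw', randomPoint_of_lt x₁ x₂ a ζ ⟨y, hy⟩ h, hw]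
    · have hs' := hs.eventually_lt_const h
      rw [← show map Subtype.val (𝓝 (⟨y, hy⟩ : ↥Xᶜ)) = 𝓝 y from
        hX.isOpen_compl.isOpenEmbedding_subtypeVal.map_nhds_eq _, eventually_map] at hs' ⊢
      filter_upwards [hζω 0, hs'] with w hw hw'
      rw [randomPoint_of_ge x₁ x₂ a ζ w hw'.le, randomPoint_of_ge x₁ x₂ a ζ ⟨y, hy⟩ h.le, hw]

end RandomPoint

theorem codingWeight_pos {Y : Type*} [MetricSpace Y] {X : Set Y} (hX : IsClosed X)
    (hne : X.Nonempty) {y : Y} (hy : y ∉ X) : 0 < codingWeight X y :=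
  lt_min ((hX.notMem_iff_infDist_pos hne).1 hy) (by norm_num)

/-- Labels assigning to every point of the complement of a closed set `X`, at every scale `n`, a
random nearby point of the complement, together with a choice of nearby points of `X`. -/
theorem exists_labels {Y : Type*} [MetricSpace Y] {X : Set Y} (hX : IsClosed X)
    (hne : X.Nonempty) :
    ∃ (a : ↥Xᶜ → X) (ζ : ℕ → ↥Xᶜ → SimpleFunc ℝ ↥Xᶜ),
      (∀ (z : ↥Xᶜ) t, dist (z : Y) (a (ζ 0 z t)) ≤ 4 * Metric.infDist (z : Y) X) ∧
      (∀ (n : ℕ) (y z : ↥Xᶜ), 2 * (1 / ((n : ℝ) + 1)) ≤ dist y z → ∀ t, ζ n y t ≠ ζ n z t) ∧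
      (∀ n z, ∃ J : Finset ↥Xᶜ, ∀ᶠ w in 𝓝 z, ∀ t, ζ n w t ∈ J) ∧
      (∀ n z, ∀ᵐ t ∂unitUniform, ∀ᶠ w in 𝓝 z, ζ n w t = ζ n z t) := by
  have hpos : ∀ i : ↥Xᶜ, 0 < Metric.infDist (i : Y) X := fun i =>
    (hX.notMem_iff_infDist_pos hne).1 i.2
  have ha : ∀ i : ↥Xᶜ, ∃ x : X, dist (i : Y) x < 2 * Metric.infDist (i : Y) X := fun i => by
    obtain ⟨x, hx, h⟩ := (Metric.infDist_lt_iff hne).1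
      (show Metric.infDist (i : Y) X < 2 * Metric.infDist (i : Y) X by linarith [hpos i])
    exact ⟨⟨x, hx⟩, h⟩
  choose a ha using ha
  choose ζ hr hJ hζ using fun n : ℕ => exists_random_label
    (fun i : ↥Xᶜ => min (Metric.infDist (i : Y) X / 4) (1 / ((n : ℝ) + 1)))
    (fun i => lt_min (by linarith [hpos i]) (by positivity))
  refine ⟨a, ζ, fun z t => ?_, fun n y z hyz t h => ?_, hJ, hζ⟩
  · have h1 : dist (z : Y) (ζ 0 z t) < _ := (hr 0 z t).trans_le (min_le_left _ _)
    have h2 := ha (ζ 0 z t)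
    have h3 := dist_triangle (z : Y) (ζ 0 z t) (a (ζ 0 z t))
    have h4 := Metric.infDist_le_infDist_add_dist (s := X) (x := (ζ 0 z t : Y)) (y := z)
    rw [dist_comm] at h4
    linarith [Metric.infDist_nonneg (s := X) (x := (z : Y))]
  · have h1 := (hr n y t).trans_le (min_le_right _ _)
    have h2 := (hr n z t).trans_le (min_le_right _ _)
    rw [← h] at h2
    linarith [dist_triangle_right y z (ζ n y t)]

section Separation

variable {Y : Type*} [MetricSpace Y] {X : Set Y} {x₁ x₂ : X} (hne : x₁ ≠ x₂)
  {a : ↥Xᶜ → X} {ζ : ℕ → ↥Xᶜ → SimpleFunc ℝ ↥Xᶜ} {p : X × X → ℝ} (hp : IsMetricFun p)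
include hne hp

theorem exists_lt_dist_of_mem
    (ha : ∀ (z : ↥Xᶜ) t, dist (z : Y) (a (ζ 0 z t)) ≤ 4 * Metric.infDist (z : Y) X)
    (hpa : IsAdmissible p) (z : X) {r : ℝ} (hr : 0 < r) :
    ∃ ε, 0 < ε ∧ ∀ w : Y,
      expectationOperator (labelMeasure ↥Xᶜ) (randomPoint x₁ x₂ a ζ) p (z, w) < ε →
        dist w z < r := by
  have hpm := IsPseudometric.expectationOperator (labelMeasure ↥Xᶜ) (randomPoint x₁ x₂ a ζ) hp.1
  obtain ⟨η, hη, hball⟩ := hpa.2 z _ (Metric.ball_mem_nhds z (half_pos hr))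
  have hD : 0 < p (x₁, x₂) := (hp.1.1 _ _).lt_of_ne fun h => hne (hp.2 _ _ h.symm)
  have hn0 : 0 < (poissonMeasure 1).real {0} := poissonMeasure_real_singleton_pos 0 one_pos
  have hσ : 0 < min (r / 8) (1 / 2) := by positivity
  refine ⟨min (η / 2) (min (r / 8) (1 / 2) * (poissonMeasure 1).real {0} * (p (x₁, x₂) / 4)),
    by positivity, fun w hw => ?_⟩
  obtain ⟨hw1, hw2⟩ := lt_min_iff.1 hw
  have hδ : Metric.infDist w X < r / 8 := by
    by_cases hwX : w ∈ X
    · rw [Metric.infDist_zero_of_mem hwX]; positivity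
    · by_contra! h
      refine hw2.not_ge ?_
      rw [hpm.2.2.1]
      refine le_trans ?_ (le_expectationOperator_randomPoint x₁ x₂ a ζ hp.1 ⟨w, hwX⟩ z 0
        fun h => absurd z.2 h)
      gcongr
      exact min_le_min_right _ h
  obtain ⟨ω, hω1, hω2⟩ : ∃ ω : (ℝ × ℕ) × (↥Xᶜ → ℝ), 1 / 2 ≤ ω.1.1 ∧
      p (z, randomPoint x₁ x₂ a ζ w ω) < η := by
    by_contra! H
    have hE : MeasurableSet {ω : (ℝ × ℕ) × (↥Xᶜ → ℝ) | 1 / 2 ≤ ω.1.1} :=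
      measurableSet_le measurable_const (measurable_fst.comp measurable_fst)
    have hmeas : (labelMeasure ↥Xᶜ).real {ω | 1 / 2 ≤ ω.1.1} = 1 / 2 := by
      have : {ω : (ℝ × ℕ) × (↥Xᶜ → ℝ) | 1 / 2 ≤ ω.1.1} = (Ici (1 / 2) ×ˢ univ) ×ˢ univ := by
        ext ω; simp
      rw [this, labelMeasure, measureReal_prod_prod, measureReal_prod_prod, measureReal_def,
        unitUniform_Ici (by norm_num), ENNReal.toReal_ofReal (by norm_num)]
      norm_num
    refine hw1.not_ge ?_
    calc η / 2 = ∫ ω, {ω : (ℝ × ℕ) × (↥Xᶜ → ℝ) | 1 / 2 ≤ ω.1.1}.indicator (fun _ => η) ω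
          ∂labelMeasure ↥Xᶜ := by
          rw [integral_indicator_const _ hE, hmeas, smul_eq_mul]; ring
      _ ≤ _ := by
          refine integral_mono ((integrable_const _).indicator hE)
            (integrable_simpleFunc_pair (labelMeasure ↥Xᶜ) (randomPoint x₁ x₂ a ζ z)
              (randomPoint x₁ x₂ a ζ w) p) fun ω => ?_
          refine indicator_le' (fun ω hω => ?_) (fun ω _ => hp.1.1 _ _) ω
          rw [randomPoint_coe]
          exact H ω hω
  have h1 : dist (randomPoint x₁ x₂ a ζ w ω : Y) z < r / 2 := hball hω2
  have h2 := dist_randomPoint_le x₁ x₂ ha w ((min_le_right _ _).trans hω1)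
  linarith [dist_triangle w (randomPoint x₁ x₂ a ζ w ω) z]

variable (hX : IsClosed X)
  (hsep : ∀ (n : ℕ) (y z : ↥Xᶜ), 2 * (1 / ((n : ℝ) + 1)) ≤ dist y z → ∀ t, ζ n y t ≠ ζ n z t)
include hX hsep

theorem exists_lt_dist_of_notMem {y : Y} (hy : y ∉ X) {r : ℝ} (hr : 0 < r) :
    ∃ ε, 0 < ε ∧ ∀ w,
      expectationOperator (labelMeasure ↥Xᶜ) (randomPoint x₁ x₂ a ζ) p (y, w) < ε →
        dist y w < r := by
  obtain ⟨n, hn⟩ := exists_nat_one_div_lt (half_pos hr)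
  have hD : 0 < p (x₁, x₂) := (hp.1.1 _ _).lt_of_ne fun h => hne (hp.2 _ _ h.symm)
  have hs := codingWeight_pos hX ⟨x₁, x₁.2⟩ hy
  have hn0 : 0 < (poissonMeasure 1).real {n} := poissonMeasure_real_singleton_pos n one_pos
  refine ⟨codingWeight X y * (poissonMeasure 1).real {n} * (p (x₁, x₂) / 4), by positivity,
    fun w => ?_⟩
  contrapose!
  intro hw
  exact le_expectationOperator_randomPoint x₁ x₂ a ζ hp.1 ⟨y, hy⟩ w n fun h =>
    hsep n ⟨y, hy⟩ ⟨w, h⟩ (by rw [Subtype.dist_eq]; linarith)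

theorem isMetricFun_expectationOperator_randomPoint :
    IsMetricFun (expectationOperator (labelMeasure ↥Xᶜ) (randomPoint x₁ x₂ a ζ) p) := by
  have hpm := IsPseudometric.expectationOperator (labelMeasure ↥Xᶜ) (randomPoint x₁ x₂ a ζ) hp.1
  have key : ∀ y w, y ∉ X →
      expectationOperator (labelMeasure ↥Xᶜ) (randomPoint x₁ x₂ a ζ) p (y, w) = 0 → y = w := by
    intro y w hy h
    by_contra hyw
    obtain ⟨ε, hε, H⟩ := exists_lt_dist_of_notMem hne hp hX hsep hy (dist_pos.2 hyw)
    exact (H w (h.trans_lt hε)).false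
  refine ⟨hpm, fun y w h => ?_⟩
  by_cases hy : y ∈ X
  · by_cases hw : w ∈ X
    · have hreg := isRegularExtensionOperator_expectationOperator (labelMeasure ↥Xᶜ)
        (randomPoint x₁ x₂ a ζ) (randomPoint_coe x₁ x₂ a ζ)
      have := hreg.2.2.2 p ⟨y, hy⟩ ⟨w, hw⟩
      exact congrArg Subtype.val (hp.2 _ _ (this.symm.trans h))
    · exact (key w y hw ((hpm.2.2.1 _ _).trans h)).symm
  · exact key y w hy h

end Separation

theorem exists_regular_extension_operator_admissible {Y : Type*} [TopologicalSpace Y]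
    [TopologicalSpace.MetrizableSpace Y]
    (X : Set Y) (hX : IsClosed X)
    (x₁ x₂ : Y) (hx₁ : x₁ ∈ X) (hx₂ : x₂ ∈ X) (hne : x₁ ≠ x₂) :
    ∃ T : (↥X × ↥X → ℝ) → (Y × Y → ℝ),
      IsRegularExtensionOperator X T ∧
      (∀ p : ↥X × ↥X → ℝ, Continuous p → Continuous (T p)) ∧
      (∀ p : ↥X × ↥X → ℝ, IsPseudometric p → IsPseudometric (T p)) ∧
      (∀ p : ↥X × ↥X → ℝ, IsMetricFun p → IsMetricFun (T p)) ∧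
      (∀ p : ↥X × ↥X → ℝ, IsMetricFun p → IsAdmissible p →
        IsMetricFun (T p) ∧ IsAdmissible (T p)) := by
  let _ := TopologicalSpace.metrizableSpaceMetric Y
  obtain ⟨a, ζ, ha, hsep, hJ, hζ⟩ := exists_labels hX ⟨x₁, hx₁⟩
  let ξ := randomPoint (⟨x₁, hx₁⟩ : X) ⟨x₂, hx₂⟩ a ζ
  have hne' : (⟨x₁, hx₁⟩ : X) ≠ ⟨x₂, hx₂⟩ := fun h => hne (congrArg Subtype.val h)
  have hcont : ∀ p : ↥X × ↥X → ℝ, Continuous p →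
      Continuous (expectationOperator (labelMeasure ↥Xᶜ) ξ p) := fun p =>
    continuous_expectationOperator _ ξ (ae_tendsto_randomPoint _ _ ha hX hζ)
      (exists_compact_randomPoint _ _ ha hX (hJ 0))
  have hmet : ∀ p : ↥X × ↥X → ℝ, IsMetricFun p →
      IsMetricFun (expectationOperator (labelMeasure ↥Xᶜ) ξ p) := fun p hp =>
    isMetricFun_expectationOperator_randomPoint hne' hp hX hsep
  refine ⟨expectationOperator (labelMeasure ↥Xᶜ) ξ,
    isRegularExtensionOperator_expectationOperator _ ξ (randomPoint_coe _ _ a ζ), hcont,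
    fun p => IsPseudometric.expectationOperator _ ξ, hmet,
    fun p hp hpa => ⟨hmet p hp, hcont p hpa.1, fun z U hU => ?_⟩⟩
  obtain ⟨r, hr, hrU⟩ := Metric.mem_nhds_iff.1 hU
  by_cases hz : z ∈ X
  · obtain ⟨ε, hε, H⟩ := exists_lt_dist_of_mem hne' hp ha hpa ⟨z, hz⟩ hr
    exact ⟨ε, hε, fun w hw => hrU (H w hw)⟩
  · obtain ⟨ε, hε, H⟩ := exists_lt_dist_of_notMem hne' hp hX hsep hz hr
    exact ⟨ε, hε, fun w hw => hrU (Metric.mem_ball'.2 (H w hw))⟩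
end

section
/- Let Y be a completely metrizable topological space (its topology is induced by some complete metric) and let X ⊆ Y be a compact closed subset containing at least two points, equipped with the subspace topology. Then there exists a regular extension operator T : (X × X → ℝ) → (Y × Y → ℝ) mapping continuous functions to continuous functions and pseudometrics to pseudometrics, such that for every continuous metric p on X the function T(p) is a complete bounded admissible metric on Y; in particular every sequence (y_n) in Y that is Cauchy with respect to T(p) converges in Y with respect to T(p). -/
open Filter Topology

/-- A distance function is complete if every Cauchy sequence for it converges
with respect to it. -/
def IsCompleteFun {Z : Type*} (d : Z × Z → ℝ) : Prop :=
  ∀ z : ℕ → Z, (∀ ε : ℝ, 0 < ε → ∃ N : ℕ, ∀ n ≥ N, ∀ m ≥ N, d (z n, z m) < ε) →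
    ∃ z₀ : Z, Tendsto (fun n => d (z n, z₀)) atTop (nhds 0)

open MeasureTheory Set unitInterval

/-- A copy of `Y` carrying the discrete topology. -/
structure DiscreteCopy (Y : Type*) where
  /-- The underlying point. -/
  point : Y

instance (Y : Type*) : TopologicalSpace (DiscreteCopy Y) := ⊥

instance (Y : Type*) : DiscreteTopology (DiscreteCopy Y) := ⟨rfl⟩

/-- The value of a symbol under a fair coin toss: a point stands for itself, whereas a code takes
the value `a` or `b`. -/
def symbolValue {X C : Type*} (a b : X) : X ⊕ C → Bool → X
  | .inl x, _ => x
  | .inr _, i => bif i then a else b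

open scoped Classical in
/-- The expected value of `p` at two symbols, where distinct codes use independent coins. -/
noncomputable def symbolKernel {X C : Type*} (a b : X) (p : X × X → ℝ) (w : (X ⊕ C) × (X ⊕ C)) :
    ℝ :=
  if w.1 = w.2 then
    (p (symbolValue a b w.1 true, symbolValue a b w.1 true) +
      p (symbolValue a b w.1 false, symbolValue a b w.1 false)) / 2
  else
    (p (symbolValue a b w.1 true, symbolValue a b w.2 true) +
      p (symbolValue a b w.1 true, symbolValue a b w.2 false) +
      p (symbolValue a b w.1 false, symbolValue a b w.2 true) +
      p (symbolValue a b w.1 false, symbolValue a b w.2 false)) / 4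

namespace symbolKernel

variable {X C : Type*} {a b : X} {p : X × X → ℝ}

theorem apply_inl_inl (x y : X) :
    symbolKernel a b p ((.inl x : X ⊕ C), (.inl y : X ⊕ C)) = p (x, y) := by
  by_cases h : x = y
  · subst h; simp [symbolKernel, symbolValue]
  · simp only [symbolKernel, symbolValue, Sum.inl.injEq, h, if_false]; ring

theorem apply_inl_inr (x : X) (c : C) :
    symbolKernel a b p ((.inl x : X ⊕ C), (.inr c : X ⊕ C)) = (p (x, a) + p (x, b)) / 2 := by
  simp only [symbolKernel, symbolValue, reduceCtorEq, if_false, cond_true, cond_false]; ring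

theorem apply_inr_inl (x : X) (c : C) :
    symbolKernel a b p ((.inr c : X ⊕ C), (.inl x : X ⊕ C)) = (p (a, x) + p (b, x)) / 2 := by
  simp only [symbolKernel, symbolValue, reduceCtorEq, if_false, cond_true, cond_false]; ring

theorem linear (p q : X × X → ℝ) (r s : ℝ) (w : (X ⊕ C) × (X ⊕ C)) :
    symbolKernel a b (fun z => r * p z + s * q z) w =
      r * symbolKernel a b p w + s * symbolKernel a b q w := by
  unfold symbolKernel
  split_ifs <;> ring

theorem one (w : (X ⊕ C) × (X ⊕ C)) : symbolKernel a b (fun _ => 1) w = 1 := by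
  unfold symbolKernel
  split_ifs <;> norm_num

theorem nonneg (hp : ∀ z, 0 ≤ p z) (w : (X ⊕ C) × (X ⊕ C)) : 0 ≤ symbolKernel a b p w := by
  unfold symbolKernel
  split_ifs <;> have := fun i j => hp (symbolValue a b w.1 i, symbolValue a b w.2 j)
  · exact div_nonneg (add_nonneg (hp _) (hp _)) zero_le_two
  · exact div_nonneg (add_nonneg (add_nonneg (add_nonneg (hp _) (hp _)) (hp _)) (hp _)) zero_le_four

theorem abs_le_of_forall {M : ℝ} {w : (X ⊕ C) × (X ⊕ C)}
    (h : ∀ i j, |p (symbolValue a b w.1 i, symbolValue a b w.2 j)| ≤ M) :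
    |symbolKernel a b p w| ≤ M := by
  have h' := fun i j => abs_le.1 (h i j)
  have h1 := h' true true
  have h2 := h' true false
  have h3 := h' false true
  have h4 := h' false false
  unfold symbolKernel
  split_ifs with hw
  · rw [← hw] at h1 h4
    exact abs_le.2 ⟨by linarith, by linarith⟩
  · exact abs_le.2 ⟨by linarith, by linarith⟩

theorem isPseudometric (hp : IsPseudometric p) :
    IsPseudometric (symbolKernel a b p : (X ⊕ C) × (X ⊕ C) → ℝ) := by
  obtain ⟨h0, hd, hs, ht⟩ := hp
  have hself : ∀ s : X ⊕ C, symbolKernel a b p (s, s) = 0 := fun s => by simp [symbolKernel, hd]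
  have hnn : ∀ s t : X ⊕ C, 0 ≤ symbolKernel a b p (s, t) :=
    fun s t => nonneg (fun z => h0 z.1 z.2) _
  refine ⟨hnn, hself, fun s t => ?_, fun s t u => ?_⟩
  · by_cases h : s = t
    · rw [h]
    · simp only [symbolKernel, h, Ne.symm h, if_false]
      simp only [hs (symbolValue a b t _) (symbolValue a b s _)]
      ring
  · by_cases hsu : s = u
    · rw [hsu, hself]; exact add_nonneg (hnn _ _) (hnn _ _)
    by_cases hst : s = t
    · rw [hst, hself, zero_add]
    by_cases htu : t = u
    · rw [htu, hself, add_zero]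
    simp only [symbolKernel, hsu, hst, htu, if_false]
    have := fun i j k => ht (symbolValue a b s i) (symbolValue a b t j) (symbolValue a b u k)
    linarith [this true true true, this true true false, this true false true,
      this true false false, this false true true, this false true false, this false false true,
      this false false false]

theorem apply_inr_inr_of_ne (hp : IsPseudometric p) {c d : C} (h : c ≠ d) :
    symbolKernel a b p ((.inr c : X ⊕ C), (.inr d : X ⊕ C)) = p (a, b) / 2 := by
  simp only [symbolKernel, symbolValue, Sum.inr.injEq, h, if_false, cond_true, cond_false,
    hp.2.1, hp.2.2.1 b a]
  ring

theorem continuous [TopologicalSpace X] [TopologicalSpace C] [DiscreteTopology C]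
    (hp : Continuous p) : Continuous (symbolKernel a b p : (X ⊕ C) × (X ⊕ C) → ℝ) := by
  have hl := Topology.IsOpenEmbedding.inl (X := X) (Y := C)
  have hr := Topology.IsOpenEmbedding.inr (X := X) (Y := C)
  rw [continuous_iff_continuousAt]
  rintro ⟨x | c, y | d⟩
  · refine ((hl.prodMap hl).continuousAt_iff (x := (x, y))).1 (Continuous.continuousAt ?_)
    convert hp using 1
    ext z
    exact apply_inl_inl _ _
  · refine ((hl.prodMap hr).continuousAt_iff (x := (x, d))).1 (Continuous.continuousAt ?_)
    have : Continuous fun z : X × C => (p (z.1, a) + p (z.1, b)) / 2 := by fun_prop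
    convert this using 1
    ext z
    exact apply_inl_inr _ _
  · refine ((hr.prodMap hl).continuousAt_iff (x := (c, y))).1 (Continuous.continuousAt ?_)
    have : Continuous fun z : C × X => (p (a, z.2) + p (b, z.2)) / 2 := by fun_prop
    convert this using 1
    ext z
    exact apply_inr_inl _ _
  · exact ((hr.prodMap hr).continuousAt_iff (x := (c, d))).1
      continuous_of_discreteTopology.continuousAt

end symbolKernel

/-- A family of `X ⊕ DiscreteCopy Y`-valued maps on `Ω`, indexed by `Y`, that is constant on `X`,
involves finitely many points of `X` for each index, and is locally constant in the variable and
continuous in the index outside a countable set. -/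
structure IsSymbolFamily {Y Ω : Type*} [TopologicalSpace Y] [TopologicalSpace Ω] (X : Set Y)
    (a b : X) (F : Y → Ω → X ⊕ DiscreteCopy Y) : Prop where
  apply_coe : ∀ (x : X) (ω : Ω), F x ω = .inl x
  finite_values : ∀ y, ∃ E : Set X, E.Finite ∧ ∀ ω i, symbolValue a b (F y ω) i ∈ E
  regular : ∀ y, ∃ D : Set Ω, D.Countable ∧ ∀ ω ∉ D,
    (∀ᶠ ω' in 𝓝 ω, F y ω' = F y ω) ∧ ContinuousAt (fun y' => F y' ω) y

/-- The average of `symbolKernel` along a family of symbol-valued random variables. -/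
noncomputable def averageKernel {X C Y Ω : Type*} [MeasurableSpace Ω] (μ : Measure Ω) (a b : X)
    (F : Y → Ω → X ⊕ C) (p : X × X → ℝ) (w : Y × Y) : ℝ :=
  ∫ ω, symbolKernel a b p (F w.1 ω, F w.2 ω) ∂μ

theorem abs_averageKernel_le {X C Y Ω : Type*} [MeasurableSpace Ω] {μ : Measure Ω}
    [IsProbabilityMeasure μ] {a b : X} {F : Y → Ω → X ⊕ C} {p : X × X → ℝ} {M : ℝ}
    (hM : ∀ z, |p z| ≤ M) (w : Y × Y) :
    |averageKernel μ a b F p w| ≤ M := by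
  have h : ∀ᵐ ω ∂μ, ‖symbolKernel a b p (F w.1 ω, F w.2 ω)‖ ≤ M :=
    .of_forall fun ω => symbolKernel.abs_le_of_forall fun _ _ => hM _
  simpa [averageKernel] using norm_integral_le_of_norm_le_const h

namespace IsSymbolFamily

variable {Y Ω : Type*} [TopologicalSpace Y] [TopologicalSpace Ω] {X : Set Y}
  {a b : X} {F : Y → Ω → X ⊕ DiscreteCopy Y} {p : X × X → ℝ}

theorem exists_bound (hF : IsSymbolFamily X a b F) (p : X × X → ℝ) (y z : Y) :
    ∃ M, ∀ ω, |symbolKernel a b p (F y ω, F z ω)| ≤ M := by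
  obtain ⟨D, hD, hDy⟩ := hF.finite_values y
  obtain ⟨E, hE, hEz⟩ := hF.finite_values z
  obtain ⟨M, hM⟩ := ((hD.prod hE).image fun z => |p z|).bddAbove
  exact ⟨M, fun ω => symbolKernel.abs_le_of_forall fun i j =>
    hM ⟨_, ⟨hDy ω i, hEz ω j⟩, rfl⟩⟩

theorem aestronglyMeasurable [MeasurableSpace Ω] [OpensMeasurableSpace Ω]
    [MeasurableSingletonClass Ω] {μ : Measure Ω} [NullSingletonClass μ]
    (hF : IsSymbolFamily X a b F) (p : X × X → ℝ) (y z : Y) :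
    AEStronglyMeasurable (fun ω => symbolKernel a b p (F y ω, F z ω)) μ := by
  obtain ⟨D, hD, hDy⟩ := hF.regular y
  obtain ⟨E, hE, hEz⟩ := hF.regular z
  have hDE : (D ∪ E).Countable := hD.union hE
  have hcont : ContinuousOn (fun ω => symbolKernel a b p (F y ω, F z ω)) (D ∪ E)ᶜ := by
    intro ω hω
    simp only [mem_compl_iff, mem_union, not_or] at hω
    have hev : (fun _ => symbolKernel a b p (F y ω, F z ω)) =ᶠ[𝓝 ω]
        fun ω' => symbolKernel a b p (F y ω', F z ω') := by
      filter_upwards [(hDy ω hω.1).1, (hEz ω hω.2).1] with ω' h1 h2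
      rw [h1, h2]
    exact (continuousAt_const.congr hev).continuousWithinAt
  have hmeas := hcont.aestronglyMeasurable (μ := μ) hDE.measurableSet.compl
  have hae : ∀ᵐ ω ∂μ, ω ∈ (D ∪ E)ᶜ := compl_mem_ae_iff.2 (hDE.measure_zero μ)
  rwa [Measure.restrict_eq_self_of_ae_mem hae] at hmeas

variable [MeasurableSpace Ω] [OpensMeasurableSpace Ω] [MeasurableSingletonClass Ω]
  {μ : Measure Ω} [NullSingletonClass μ] [IsProbabilityMeasure μ]

theorem integrable (hF : IsSymbolFamily X a b F) (p : X × X → ℝ) (y z : Y) :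
    Integrable (fun ω => symbolKernel a b p (F y ω, F z ω)) μ := by
  obtain ⟨M, hM⟩ := hF.exists_bound p y z
  exact .of_bound (hF.aestronglyMeasurable p y z) M (.of_forall hM)

theorem isRegularExtensionOperator (hF : IsSymbolFamily X a b F) :
    IsRegularExtensionOperator X (averageKernel μ a b F) := by
  refine ⟨fun p q r s => ?_, fun p hp w => ?_, ?_, fun p x x' => ?_⟩
  · ext w
    simp only [averageKernel, symbolKernel.linear]
    rw [integral_add ((hF.integrable p _ _).const_mul r) ((hF.integrable q _ _).const_mul s),
      integral_const_mul, integral_const_mul]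
  · exact integral_nonneg fun ω => symbolKernel.nonneg hp _
  · ext w
    simp [averageKernel, symbolKernel.one]
  · simp [averageKernel, hF.apply_coe, symbolKernel.apply_inl_inl]

theorem isPseudometric (hF : IsSymbolFamily X a b F) (hp : IsPseudometric p) :
    IsPseudometric (averageKernel μ a b F p) := by
  obtain ⟨h0, hd, hs, ht⟩ := symbolKernel.isPseudometric (C := DiscreteCopy Y) (a := a) (b := b) hp
  refine ⟨fun y z => integral_nonneg fun ω => h0 _ _, fun y => ?_, fun y z => ?_, fun x y z => ?_⟩
  · simp [averageKernel, hd]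
  · exact integral_congr_ae (.of_forall fun ω => hs _ _)
  · simp only [averageKernel]
    rw [← integral_add (hF.integrable p _ _) (hF.integrable p _ _)]
    exact integral_mono (hF.integrable p _ _) ((hF.integrable p _ _).add (hF.integrable p _ _))
      fun ω => ht _ _ _

theorem mul_le_averageKernel (hF : IsSymbolFamily X a b F) (hp : ∀ z, 0 ≤ p z) {κ : ℝ}
    {A : Set Ω} (hA : MeasurableSet A) {y z : Y}
    (h : ∀ ω ∈ A, κ ≤ symbolKernel a b p (F y ω, F z ω)) :
    κ * μ.real A ≤ averageKernel μ a b F p (y, z) := by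
  calc κ * μ.real A ≤ ∫ ω in A, symbolKernel a b p (F y ω, F z ω) ∂μ :=
        setIntegral_ge_of_const_le_real hA (measure_ne_top μ A) h
          (hF.integrable p y z).integrableOn
    _ ≤ averageKernel μ a b F p (y, z) :=
        setIntegral_le_integral (hF.integrable p y z)
          (.of_forall fun ω => symbolKernel.nonneg hp _)

theorem continuous [FirstCountableTopology Y] [CompactSpace X] (hF : IsSymbolFamily X a b F)
    (hp : Continuous p) : Continuous (averageKernel μ a b F p) := by
  obtain ⟨M, hM⟩ := (isCompact_range hp.abs).bddAbove
  have hM' : ∀ z, |p z| ≤ M := fun z => hM ⟨z, rfl⟩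
  rw [continuous_iff_continuousAt]
  rintro ⟨y, z⟩
  obtain ⟨D, hD, hDy⟩ := hF.regular y
  obtain ⟨E, hE, hEz⟩ := hF.regular z
  refine tendsto_integral_filter_of_dominated_convergence (fun _ => M)
    (.of_forall fun w => hF.aestronglyMeasurable p _ _)
    (.of_forall fun w => .of_forall fun ω => symbolKernel.abs_le_of_forall fun _ _ => hM' _)
    (integrable_const M) ?_
  filter_upwards [compl_mem_ae_iff.2 ((hD.union hE).measure_zero μ)] with ω hω
  simp only [mem_compl_iff, mem_union, not_or] at hω
  have h1 : ContinuousAt (fun w : Y × Y => F w.1 ω) (y, z) :=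
    ContinuousAt.comp (f := Prod.fst) (g := fun y' => F y' ω) (hDy ω hω.1).2 continuousAt_fst
  have h2 : ContinuousAt (fun w : Y × Y => F w.2 ω) (y, z) :=
    ContinuousAt.comp (f := Prod.snd) (g := fun y' => F y' ω) (hEz ω hω.2).2 continuousAt_snd
  exact ((symbolKernel.continuous hp).tendsto _).comp (h1.prodMk h2)

end IsSymbolFamily

/-- Every open cover of a paracompact space admits a random choice of a member containing a given
point which is locally constant outside finitely many parameters. -/
theorem exists_locallyConstant_index {Z ι : Type*} [TopologicalSpace Z] [NormalSpace Z]
    [ParacompactSpace Z] [Nonempty ι] (U : ι → Set Z) (ho : ∀ i, IsOpen (U i))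
    (hU : ∀ z, ∃ i, z ∈ U i) :
    ∃ idx : Z → I → ι, (∀ z θ, θ < 1 → z ∈ U (idx z θ)) ∧ (∀ z, (range (idx z)).Finite) ∧
      ∀ z, ∃ D : Set I, D.Finite ∧ ∀ θ ∉ D, ∀ᶠ w in 𝓝 (z, θ), idx w.1 w.2 = idx z θ := by
  obtain ⟨f, hf⟩ := BumpCovering.exists_isSubordinate isClosed_univ U ho
    fun z _ => mem_iUnion.2 (hU z)
  let act : Z → I → Set ι := fun z θ => {i | (θ : ℝ) < f i z}
  refine ⟨fun z θ => Classical.epsilon (· ∈ act z θ), fun z θ hθ => ?_, fun z => ?_, fun z => ?_⟩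
  · obtain ⟨i, hi⟩ := f.eventuallyEq_one' z (mem_univ z)
    have hiz : f i z = 1 := hi.self_of_nhds
    have hne : ∃ i, i ∈ act z θ := ⟨i, show (θ : ℝ) < f i z by rw [hiz]; exact_mod_cast hθ⟩
    have hmem : (θ : ℝ) < f (Classical.epsilon (· ∈ act z θ)) z := Classical.epsilon_spec hne
    exact hf _ (subset_tsupport _ (θ.2.1.trans_lt hmem).ne')
  · refine (((f.point_finite z).finite_subsets).image
      fun A => Classical.epsilon (· ∈ A)).subset ?_
    rintro _ ⟨θ, rfl⟩
    exact ⟨act z θ, fun i hi => (θ.2.1.trans_lt hi).ne', rfl⟩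
  · refine ⟨(fun θ : I => (θ : ℝ)) ⁻¹' (insert 0 ((fun i => f i z) '' {i | f i z ≠ 0})),
      (((f.point_finite z).image _).insert 0).preimage Subtype.val_injective.injOn,
      fun θ hθ => ?_⟩
    have hne : ∀ i, (θ : ℝ) ≠ f i z := fun i h => hθ <| by
      by_cases h0 : f i z = 0
      · exact .inl (h.trans h0)
      · exact .inr ⟨i, h0, h.symm⟩
    obtain ⟨N, hN, hfin⟩ := f.locallyFinite z
    have hev : ∀ᶠ w : Z × I in 𝓝 (z, θ), ∀ i ∈ {i | (Function.support (f i) ∩ N).Nonempty},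
        ((w.2 : ℝ) < f i w.1 ↔ (θ : ℝ) < f i z) := by
      refine (Filter.eventually_all_finite hfin).2 fun i _ => ?_
      have h1 : Continuous fun w : Z × I => (w.2 : ℝ) := by fun_prop
      have h2 : Continuous fun w : Z × I => f i w.1 := by fun_prop
      rcases lt_or_gt_of_ne (hne i) with h | h
      · filter_upwards [h1.continuousAt.eventually_lt h2.continuousAt h] with w hw
        exact iff_of_true hw h
      · filter_upwards [h2.continuousAt.eventually_lt h1.continuousAt h] with w hw
        exact iff_of_false hw.not_gt h.not_gt
    filter_upwards [hev, continuousAt_fst.preimage_mem_nhds hN] with w hw hwN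
    have : act w.1 w.2 = act z θ := by
      ext i
      by_cases hi : (Function.support (f i) ∩ N).Nonempty
      · exact hw i hi
      · have h0 : ∀ u ∈ N, f i u = 0 := fun u hu => by
          by_contra h
          exact hi ⟨u, h, hu⟩
        simp only [act, mem_ofPred_eq, h0 _ hwN, h0 _ (mem_of_mem_nhds hN)]
        exact iff_of_false w.2.2.1.not_gt θ.2.1.not_gt
    rw [this]

/-- A compact subset `X` of a metric space admits a symbol family over `ℕ × I` whose codes identify
the points outside `X` at arbitrarily small scales. -/
theorem exists_isSymbolFamily {Y : Type*} [MetricSpace Y] {X : Set Y} (hX : IsCompact X)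
    (a b : X) :
    ∃ F : Y → ℕ × I → X ⊕ DiscreteCopy Y, IsSymbolFamily X a b F ∧
      ∀ y, ∀ ω : ℕ × I, (ω.2 : ℝ) < Metric.infDist y X →
        ∃ c : Y, F y ω = .inr ⟨c⟩ ∧ (ω.2 < 1 → dist y c < (1 / 2 : ℝ) ^ ω.1) := by
  classical
  have hXne : X.Nonempty := ⟨a, a.2⟩
  have : Nonempty Y := ⟨a⟩
  let U : ℕ → Y → Set (Xᶜ : Set Y) := fun n c =>
    {z | dist (z : Y) c < (1 / 2 : ℝ) ^ n} ∩ {z | dist (z : Y) c < Metric.infDist (z : Y) X}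
  have hUo : ∀ n c, IsOpen (U n c) := fun n c =>
    (isOpen_lt (by fun_prop) continuous_const).inter
      (isOpen_lt (by fun_prop) ((Metric.continuous_infDist_pt X).comp continuous_subtype_val))
  have hpos : ∀ y ∉ X, 0 < Metric.infDist y X := fun y hy =>
    (hX.isClosed.notMem_iff_infDist_pos hXne).1 hy
  have hUc : ∀ n z, ∃ c, z ∈ U n c := fun n z =>
    ⟨z, by simp, by simpa using hpos z z.2⟩
  choose idx hidxU hidxfin B hBfin hB using
    fun n => exists_locallyConstant_index (U n) (hUo n) (hUc n)
  choose r hrX hr using fun y => hX.exists_infDist_eq_dist hXne y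
  have hr_dist : ∀ (z : (Xᶜ : Set Y)) (θ : I), θ < 1 →
      dist (r (idx 0 z θ)) z ≤ 3 * Metric.infDist (z : Y) X := fun z θ hθ => by
    have h1 : dist (z : Y) (idx 0 z θ) < Metric.infDist (z : Y) X := (hidxU 0 z θ hθ).2
    have h2 : Metric.infDist (idx 0 z θ) X ≤
        Metric.infDist (z : Y) X + dist (idx 0 z θ) (z : Y) :=
      Metric.infDist_le_infDist_add_dist
    have h3 := dist_triangle_left (r (idx 0 z θ)) (z : Y) (idx 0 z θ)
    rw [← hr] at h3
    rw [dist_comm] at h1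
    linarith
  let F : Y → ℕ × I → X ⊕ DiscreteCopy Y := fun y ω =>
    if h : y ∈ X then .inl ⟨y, h⟩
    else if (ω.2 : ℝ) < Metric.infDist y X then .inr ⟨idx ω.1 ⟨y, h⟩ ω.2⟩
    else .inl ⟨r (idx 0 ⟨y, h⟩ ω.2), hrX _⟩
  have hFX : ∀ (x : X) ω, F x ω = .inl x := fun x ω => by simp [F]
  have hFZ : ∀ (z : (Xᶜ : Set Y)) ω, F z ω =
      if (ω.2 : ℝ) < Metric.infDist (z : Y) X then .inr ⟨idx ω.1 z ω.2⟩
      else .inl ⟨r (idx 0 z ω.2), hrX _⟩ := fun z ω => dif_neg z.2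
  refine ⟨F, ⟨hFX, fun y => ?_, fun y => ?_⟩, fun y ω hω => ?_⟩
  · by_cases hy : y ∈ X
    · exact ⟨{⟨y, hy⟩}, finite_singleton _, fun ω i => by simp [hFX ⟨y, hy⟩, symbolValue]⟩
    · refine ⟨insert a (insert b ((fun c => ⟨r c, hrX c⟩) '' range (idx 0 ⟨y, hy⟩))),
        (((hidxfin 0 ⟨y, hy⟩).image _).insert b).insert a, fun ω i => ?_⟩
      rw [hFZ ⟨y, hy⟩]
      split_ifs
      · cases i <;> simp [symbolValue]
      · exact .inr (.inr ⟨_, ⟨ω.2, rfl⟩, rfl⟩)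
  · by_cases hy : y ∈ X
    · refine ⟨univ ×ˢ {0, 1}, countable_univ.prod (toFinite _).countable, fun ω hω => ?_⟩
      simp only [mem_prod, mem_univ, true_and, mem_insert_iff, mem_singleton_iff, not_or] at hω
      have hθ : (0 : ℝ) < ω.2 := unitInterval.pos_iff_ne_zero.2 hω.1
      have hθ1 : ω.2 < 1 := unitInterval.lt_one_iff_ne_one.2 hω.2
      refine ⟨.of_forall fun ω' => by rw [hFX ⟨y, hy⟩, hFX ⟨y, hy⟩], ?_⟩
      intro V hV
      change V ∈ 𝓝 (F y ω) at hV
      rw [hFX ⟨y, hy⟩] at hV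
      obtain ⟨ε, hε, hεV⟩ := Metric.mem_nhds_iff.1
        (continuous_inl.continuousAt.preimage_mem_nhds hV)
      rw [mem_map]
      filter_upwards [Metric.ball_mem_nhds y (show 0 < min (ε / 4) ω.2 by positivity)] with z hz
      have hz' := lt_min_iff.1 (Metric.mem_ball.1 hz)
      have hinf : Metric.infDist z X ≤ dist z y := Metric.infDist_le_dist_of_mem hy
      by_cases hzX : z ∈ X
      · rw [mem_preimage, hFX ⟨z, hzX⟩]
        exact hεV (show dist z y < ε by linarith)
      · rw [mem_preimage, hFZ ⟨z, hzX⟩, if_neg (by linarith : ¬ (ω.2 : ℝ) < Metric.infDist z X)]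
        refine hεV (show dist (r (idx 0 ⟨z, hzX⟩ ω.2)) y < ε from ?_)
        have h1 := hr_dist ⟨z, hzX⟩ ω.2 hθ1
        have h2 := dist_triangle (r (idx 0 ⟨z, hzX⟩ ω.2)) z y
        dsimp only at h1
        linarith
    · let z : (Xᶜ : Set Y) := ⟨y, hy⟩
      let E : Set I := B 0 z ∪ (fun θ : I => (θ : ℝ)) ⁻¹' {Metric.infDist y X}
      have hE : E.Finite :=
        (hBfin 0 z).union ((finite_singleton _).preimage Subtype.val_injective.injOn)
      refine ⟨⋃ n, {n} ×ˢ (B n z ∪ E), countable_iUnion fun n =>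
        ((finite_singleton n).prod ((hBfin n z).union hE)).countable, ?_⟩
      rintro ⟨n, θ⟩ hω
      simp only [mem_iUnion, mem_prod, mem_singleton_iff, exists_eq_left', mem_union, E, not_or,
        mem_preimage] at hω
      obtain ⟨hn, h0, hθ⟩ := hω
      suffices h : ∀ᶠ v : Y × (ℕ × I) in 𝓝 (y, (n, θ)), F v.1 v.2 = F y (n, θ) by
        constructor
        · exact (Continuous.prodMk_right y).continuousAt.eventually h
        · have h' := (Continuous.prodMk_left (n, θ)).continuousAt.eventually h
          exact continuousAt_const.congr (h'.mono fun _ => Eq.symm)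
      have hemb : IsOpenEmbedding (Prod.map ((↑) : (Xᶜ : Set Y) → Y) (id : ℕ × I → ℕ × I)) :=
        hX.isClosed.isOpen_compl.isOpenEmbedding_subtypeVal.prodMap .id
      have hmap := hemb.map_nhds_eq (z, (n, θ))
      simp only [Prod.map_apply, id] at hmap
      rw [show (y, (n, θ)) = ((z : Y), (n, θ)) from rfl, ← hmap, Filter.eventually_map]
      have hproj : Continuous fun v : (Xᶜ : Set Y) × (ℕ × I) => (v.1, v.2.2) := by fun_prop
      have hfst : Continuous fun v : (Xᶜ : Set Y) × (ℕ × I) => v.2.1 := by fun_prop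
      have hsnd : Continuous fun v : (Xᶜ : Set Y) × (ℕ × I) => (v.2.2 : ℝ) := by fun_prop
      have hinf : Continuous fun v : (Xᶜ : Set Y) × (ℕ × I) => Metric.infDist (v.1 : Y) X :=
        (Metric.continuous_infDist_pt X).comp (by fun_prop)
      have hev : ∀ᶠ v : (Xᶜ : Set Y) × (ℕ × I) in 𝓝 (z, (n, θ)), v.2.1 = n :=
        hfst.continuousAt.eventually (p := fun m => m = n) (by simp)
      have hn' := (hproj.tendsto (z, (n, θ))).eventually (hB n z θ hn)
      have h0' := (hproj.tendsto (z, (n, θ))).eventually (hB 0 z θ h0)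
      have hFy := hFZ z (n, θ)
      simp only [Prod.map_fst, Prod.map_snd, id, hFZ]
      rw [hFy]
      rcases lt_or_gt_of_ne hθ with h | h
      · filter_upwards [hev, hn', hsnd.continuousAt.eventually_lt hinf.continuousAt h]
          with v h1 h2 h3
        rw [if_pos h3, if_pos (show (θ : ℝ) < Metric.infDist (z : Y) X from h), h1, h2]
      · filter_upwards [h0', hinf.continuousAt.eventually_lt hsnd.continuousAt h] with v h2 h3
        rw [if_neg h3.not_gt, if_neg (show ¬ (θ : ℝ) < Metric.infDist (z : Y) X from h.not_gt)]
        simp only [h2]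
  · have hy : y ∉ X := fun hy => by
      rw [Metric.infDist_zero_of_mem hy] at hω
      exact hω.not_ge ω.2.2.1
    refine ⟨idx ω.1 ⟨y, hy⟩ ω.2, ?_, fun h1 => (hidxU ω.1 ⟨y, hy⟩ ω.2 h1).1⟩
    rw [hFZ ⟨y, hy⟩, if_pos hω]

/-- A fully supported atomless probability measure on `ℕ × I`. -/
theorem exists_probability_nat_prod_unitInterval :
    ∃ μ : Measure (ℕ × I), IsProbabilityMeasure μ ∧ NullSingletonClass μ ∧
      ∀ n δ, 0 < δ → 0 < μ.real ({n} ×ˢ Iio δ) := by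
  refine ⟨(ProbabilityTheory.poissonMeasure 1).prod volume, inferInstance, inferInstance,
    fun n δ hδ => ?_⟩
  rw [measureReal_prod_prod]
  refine mul_pos (ProbabilityTheory.poissonMeasure_real_singleton_pos n one_pos) ?_
  rw [measureReal_def, unitInterval.volume_Iio]
  rw [ENNReal.toReal_ofReal δ.2.1]
  exact hδ

/-- A continuous metric whose Cauchy sequences have topologically convergent subsequences is
admissible and complete. -/
theorem IsMetricFun.isAdmissible_and_isCompleteFun {Y : Type*} [TopologicalSpace Y] {d : Y × Y → ℝ}
    (hd : IsMetricFun d) (hc : Continuous d)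
    (hsub : ∀ z : ℕ → Y, (∀ ε : ℝ, 0 < ε → ∃ N : ℕ, ∀ n ≥ N, ∀ m ≥ N, d (z n, z m) < ε) →
      ∃ y, ∃ φ : ℕ → ℕ, StrictMono φ ∧ Tendsto (z ∘ φ) atTop (𝓝 y)) :
    IsAdmissible d ∧ IsCompleteFun d := by
  obtain ⟨⟨h0, hdiag, hsymm, htri⟩, heq⟩ := hd
  have hlim : ∀ (u : Y) (z : ℕ → Y) (y : Y), Tendsto z atTop (𝓝 y) →
      Tendsto (fun n => d (u, z n)) atTop (𝓝 (d (u, y))) := fun u z y h =>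
    ((hc.comp (Continuous.prodMk_right u)).tendsto y).comp h
  refine ⟨⟨hc, fun z U hU => ?_⟩, fun z hz => ?_⟩
  · by_contra! hcon
    have hex : ∀ n : ℕ, ∃ y, d (z, y) < 1 / ((n : ℝ) + 1) ∧ y ∉ U := fun n => by
      obtain ⟨y, hy, hyU⟩ := not_subset.1 (hcon (1 / ((n : ℝ) + 1)) (by positivity))
      exact ⟨y, hy, hyU⟩
    choose y hy hyU using hex
    have hlim0 : Tendsto (fun n => d (z, y n)) atTop (𝓝 0) :=
      squeeze_zero (fun n => h0 _ _) (fun n => (hy n).le) tendsto_one_div_add_atTop_nhds_zero_nat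
    obtain ⟨c, φ, hφ, hcφ⟩ := hsub y fun ε hε => by
      obtain ⟨N, hN⟩ := eventually_atTop.1 (hlim0.eventually_lt_const (half_pos hε))
      refine ⟨N, fun n hn m hm => ?_⟩
      have := htri (y n) z (y m)
      rw [hsymm (y n) z] at this
      linarith [hN n hn, hN m hm]
    have hzc : z = c :=
      heq _ _ (tendsto_nhds_unique (hlim z _ c hcφ) (hlim0.comp hφ.tendsto_atTop))
    subst hzc
    obtain ⟨n, hn⟩ := (hcφ.eventually_mem hU).exists
    exact hyU _ hn
  · obtain ⟨c, φ, hφ, hcφ⟩ := hsub z hz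
    refine ⟨c, tendsto_order.2 ⟨fun r hr => .of_forall fun n => hr.trans_le (h0 _ _),
      fun ε hε => ?_⟩⟩
    obtain ⟨N, hN⟩ := hz (ε / 2) (half_pos hε)
    have h1 := hlim c _ c hcφ
    rw [hdiag] at h1
    obtain ⟨k, hk, hkN⟩ := ((h1.eventually_lt_const (half_pos hε)).and
      (hφ.tendsto_atTop.eventually_ge_atTop N)).exists
    filter_upwards [eventually_ge_atTop N] with n hn
    have h2 := htri (z n) (z (φ k)) c
    rw [hsymm (z (φ k)) c] at h2
    have h3 := hN n hn _ hkN
    simp only [Function.comp_apply] at hk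
    linarith

/-- A sequence whose terms come arbitrarily close to a compact set has a subsequence converging to
a point of that set. -/
theorem IsCompact.exists_tendsto_subseq_of_frequently_infDist_lt {Y : Type*} [MetricSpace Y]
    {X : Set Y} (hX : IsCompact X) (hXne : X.Nonempty) {z : ℕ → Y}
    (hz : ∀ δ : ℝ, 0 < δ → ∃ᶠ n in atTop, Metric.infDist (z n) X < δ) :
    ∃ y, ∃ φ : ℕ → ℕ, StrictMono φ ∧ Tendsto (z ∘ φ) atTop (𝓝 y) := by
  obtain ⟨φ, hφ, hφz⟩ := extraction_forall_of_frequently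
    fun n : ℕ => hz (1 / ((n : ℝ) + 1)) (by positivity)
  choose r hrX hr using fun y => hX.exists_infDist_eq_dist hXne y
  obtain ⟨y, -, ψ, hψ, hy⟩ := hX.tendsto_subseq fun n => hrX (z (φ n))
  refine ⟨y, φ ∘ ψ, hφ.comp hψ, hy.congr_dist ?_⟩
  have h0 : Tendsto (fun n => dist (r (z (φ n))) (z (φ n))) atTop (𝓝 0) :=
    squeeze_zero (fun n => dist_nonneg)
      (fun n => by rw [dist_comm, ← hr]; exact (hφz n).le) tendsto_one_div_add_atTop_nhds_zero_nat
  exact h0.comp hψ.tendsto_atTop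

theorem exists_regular_extension_operator_complete {Y : Type*} [t : TopologicalSpace Y]
    (hY : ∃ m : MetricSpace Y, m.toUniformSpace.toTopologicalSpace = t ∧
      @CompleteSpace Y m.toUniformSpace)
    (X : Set Y) (hXcomp : IsCompact X) (hXcl : IsClosed X)
    (x₁ x₂ : Y) (hx₁ : x₁ ∈ X) (hx₂ : x₂ ∈ X) (hne : x₁ ≠ x₂) :
    ∃ T : (↥X × ↥X → ℝ) → (Y × Y → ℝ),
      IsRegularExtensionOperator X T ∧
      (∀ p : ↥X × ↥X → ℝ, Continuous p → Continuous (T p)) ∧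
      (∀ p : ↥X × ↥X → ℝ, IsPseudometric p → IsPseudometric (T p)) ∧
      (∀ p : ↥X × ↥X → ℝ, IsMetricFun p → Continuous p →
        IsMetricFun (T p) ∧ IsAdmissible (T p) ∧
        (∃ M : ℝ, ∀ w : Y × Y, |T p w| ≤ M) ∧ IsCompleteFun (T p)) := by
  obtain ⟨m, rfl, hcomplete⟩ := hY
  have : CompactSpace X := isCompact_iff_compactSpace.1 hXcomp
  have hXne : X.Nonempty := ⟨x₁, hx₁⟩
  let a : X := ⟨x₁, hx₁⟩
  let b : X := ⟨x₂, hx₂⟩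
  obtain ⟨μ, hμ, hμ0, hμpos⟩ := exists_probability_nat_prod_unitInterval
  obtain ⟨F, hF, hcode⟩ := exists_isSymbolFamily hXcomp a b
  refine ⟨averageKernel μ a b F, hF.isRegularExtensionOperator, fun p => hF.continuous,
    fun p => hF.isPseudometric, fun p hp hpc => ?_⟩
  obtain ⟨⟨h0, hdiag, hsymm, htri⟩, heq⟩ := hp
  have hpps : IsPseudometric p := ⟨h0, hdiag, hsymm, htri⟩
  have hp0 : ∀ z, 0 ≤ p z := fun z => h0 z.1 z.2
  have hab : 0 < p (a, b) :=
    (h0 a b).lt_of_ne fun h => hne (congrArg Subtype.val (heq a b h.symm))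
  have hT := hF.isPseudometric (μ := μ) hpps
  have hTc := hF.continuous (μ := μ) hpc
  have hscale : ∀ δ : ℝ, 0 < δ → ∃ θ : I, 0 < θ ∧ (θ : ℝ) ≤ δ := fun δ hδ =>
    ⟨⟨min δ 1, by positivity, min_le_right _ _⟩, show 0 < min δ 1 by positivity, min_le_left _ _⟩
  have hmeas : ∀ (n : ℕ) (θ : I), MeasurableSet (({n} : Set ℕ) ×ˢ Iio θ) := fun n θ =>
    (measurableSet_singleton n).prod measurableSet_Iio
  have hfar : ∀ δ ε : ℝ, 0 < δ → 0 < ε → ∃ η, 0 < η ∧ ∀ y z, δ ≤ Metric.infDist y X →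
      δ ≤ Metric.infDist z X → averageKernel μ a b F p (y, z) < η → dist y z < ε := by
    intro δ ε hδ hε
    obtain ⟨n, hn⟩ := exists_pow_lt_of_lt_one (half_pos hε) one_half_lt_one
    obtain ⟨θ, hθ, hθδ⟩ := hscale δ hδ
    refine ⟨p (a, b) / 2 * μ.real ({n} ×ˢ Iio θ), mul_pos (half_pos hab) (hμpos n θ hθ),
      fun y z hy hz hyz => ?_⟩
    by_contra! hfar
    refine hyz.not_ge (hF.mul_le_averageKernel hp0 (hmeas n θ) ?_)
    rintro ⟨_, τ⟩ ⟨rfl, hτ⟩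
    have hτδ : (τ : ℝ) < δ := (show (τ : ℝ) < θ from hτ).trans_le hθδ
    have hτ1 : τ < 1 := (show τ < θ from hτ).trans_le θ.2.2
    obtain ⟨c, hc, hcy⟩ := hcode y (_, τ) (hτδ.trans_le hy)
    obtain ⟨e, he, hez⟩ := hcode z (_, τ) (hτδ.trans_le hz)
    rw [hc, he]
    refine (symbolKernel.apply_inr_inr_of_ne hpps fun h => ?_).ge
    obtain rfl : c = e := congrArg DiscreteCopy.point h
    have := dist_triangle_right y z c
    linarith [hcy hτ1, hez hτ1]
  have hmixed : ∀ (x : X) (z : Y), z ∉ X → 0 < averageKernel μ a b F p (x, z) := by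
    intro x z hz
    obtain ⟨θ, hθ, hθδ⟩ := hscale _ ((hXcl.notMem_iff_infDist_pos hXne).1 hz)
    refine (mul_pos (half_pos hab) (hμpos 0 θ hθ)).trans_le
      (hF.mul_le_averageKernel hp0 (hmeas 0 θ) ?_)
    rintro ω ⟨-, hτ⟩
    obtain ⟨c, hc, -⟩ := hcode z ω ((show (ω.2 : ℝ) < θ from hτ).trans_le hθδ)
    rw [hc, hF.apply_coe, symbolKernel.apply_inl_inr]
    linarith [htri a x b, hsymm a x]
  have hmetric : IsMetricFun (averageKernel μ a b F p) := by
    refine ⟨hT, fun y z hyz => ?_⟩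
    by_cases hy : y ∈ X <;> by_cases hz : z ∈ X
    · have h := hF.isRegularExtensionOperator (μ := μ) |>.2.2.2 p ⟨y, hy⟩ ⟨z, hz⟩
      exact congrArg Subtype.val (heq _ _ (h.symm.trans hyz))
    · exact absurd hyz (hmixed ⟨y, hy⟩ z hz).ne'
    · exact absurd ((hT.2.2.1 z y).trans hyz) (hmixed ⟨z, hz⟩ y hy).ne'
    · refine eq_of_forall_dist_le fun ε hε => ?_
      obtain ⟨η, hη, h⟩ := hfar _ ε (lt_min ((hXcl.notMem_iff_infDist_pos hXne).1 hy)
        ((hXcl.notMem_iff_infDist_pos hXne).1 hz)) hε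
      exact (h y z (min_le_left _ _) (min_le_right _ _) (hyz.trans_lt hη)).le
  obtain ⟨hadm, hcpl⟩ := hmetric.isAdmissible_and_isCompleteFun hTc fun z hz => by
    by_cases hnear : ∀ δ : ℝ, 0 < δ → ∃ᶠ n in atTop, Metric.infDist (z n) X < δ
    · exact hXcomp.exists_tendsto_subseq_of_frequently_infDist_lt hXne hnear
    · push Not at hnear
      obtain ⟨δ, hδ, hev⟩ := hnear
      obtain ⟨K, hK⟩ := eventually_atTop.1 hev
      have hcauchy : CauchySeq z := Metric.cauchySeq_iff.2 fun ε hε => by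
        obtain ⟨η, hη, h⟩ := hfar δ ε hδ hε
        obtain ⟨N, hN⟩ := hz η hη
        exact ⟨max K N, fun n hn k hk => h _ _ (hK n (le_of_max_le_left hn))
          (hK k (le_of_max_le_left hk))
          (hN n (le_of_max_le_right hn) k (le_of_max_le_right hk))⟩
      obtain ⟨y, hy⟩ := cauchySeq_tendsto_of_complete hcauchy
      exact ⟨y, id, strictMono_id, hy⟩
  obtain ⟨M, hM⟩ := (isCompact_range hpc.abs).bddAbove
  exact ⟨hmetric, hadm, ⟨M, abs_averageKernel_le fun z => hM ⟨z, rfl⟩⟩, hcpl⟩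
end

section
/- Let Y be a metrizable topological space and X ⊆ Y a closed subset containing at least two points, equipped with the subspace topology. Then there exists a regular extension operator T : (X × X → ℝ) → (Y × Y → ℝ) mapping continuous functions to continuous functions and pseudometrics to pseudometrics, such that for every compact set C ⊆ Y × Y there exists a compact set K ⊆ X with the property: for every p : X × X → ℝ, if |p(x,x')| ≤ 1 for all x, x' ∈ K, then |T(p)(y,y')| ≤ 1 for all (y,y') ∈ C. In particular, T is continuous with respect to the compact-open topologies on the spaces of continuous functions. -/
open Set Filter Topology MeasureTheory
open scoped unitInterval

namespace RegularExtension

/-- A random index `i` with `z ∈ tsupport (f i)`, chosen among those `i` for which `f i z` exceeds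
the random threshold `(t + 1) / 3`; almost surely it is locally constant in `z`. -/
theorem exists_random_index {ι Z : Type*} [TopologicalSpace Z] (f : BumpCovering ι Z univ) :
    ∃ F : Z → SimpleFunc I ι, (∀ z t, z ∈ tsupport (f (F z t))) ∧
      ∀ z₀, ∀ᵐ t : I, ∀ᶠ z in 𝓝 z₀, F z t = F z₀ t := by
  classical
  rcases isEmpty_or_nonempty Z with hZ | ⟨⟨z₁⟩⟩
  · exact ⟨hZ.elim, fun z => hZ.elim z, fun z => hZ.elim z⟩
  have hι : Nonempty ι := ⟨f.ind z₁ (mem_univ z₁)⟩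
  let A : Z → I → Set ι := fun z t => {i | ((t : ℝ) + 1) / 3 < f i z}
  have hpos : ∀ t : I, 0 < ((t : ℝ) + 1) / 3 := fun t => by
    have := t.2.1
    linarith
  have hne : ∀ z t, (A z t).Nonempty := fun z t => by
    refine ⟨f.ind z (mem_univ z), ?_⟩
    have h1 : f (f.ind z (mem_univ z)) z = 1 := f.ind_apply z (mem_univ z)
    have := t.2.2
    change ((t : ℝ) + 1) / 3 < _
    rw [h1]
    linarith
  have hsupp : ∀ z t i, i ∈ A z t → f i z ≠ 0 := fun z t i hi =>
    ((hpos t).trans hi).ne'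
  have hsel : ∃ sel : Set ι → ι, ∀ s : Set ι, s.Nonempty → sel s ∈ s := by
    obtain ⟨i⟩ := hι
    exact ⟨fun s => if h : s.Nonempty then h.some else i, fun s h => by
      simpa [h] using h.some_mem⟩
  obtain ⟨sel, hsel⟩ := hsel
  have hfin : ∀ z, Set.Finite {i | f i z ≠ 0} := fun z => f.point_finite z
  have key : ∀ z, ∃ g : SimpleFunc I ι, ∀ t, g t = sel (A z t) := fun z => by
    have := (hfin z).to_subtype
    let G : I → ({i | f i z ≠ 0} → Prop) := fun t i => ((t : ℝ) + 1) / 3 < f i z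
    have hG : Measurable G := by
      refine measurable_pi_iff.2 fun i => ?_
      exact (measurableSet_lt (by fun_prop) measurable_const :
        MeasurableSet {t : I | ((t : ℝ) + 1) / 3 < f i z}).mem
    let h : ({i | f i z ≠ 0} → Prop) → ι := fun P => sel {i | ∃ hi, P ⟨i, hi⟩}
    have hh : ∀ t, h (G t) = sel (A z t) := fun t => by
      refine congrArg sel (Set.ext fun i => ⟨?_, ?_⟩)
      · rintro ⟨_, hi⟩
        exact hi
      · exact fun hi => ⟨hsupp z t i hi, hi⟩
    refine ⟨⟨fun t => h (G t), fun x => ?_, ?_⟩, hh⟩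
    · exact hG ((Set.toFinite {P | h P = x}).measurableSet)
    · exact (Set.finite_range h).subset (range_comp_subset_range G h)
  choose F hF using key
  refine ⟨F, fun z t => subset_closure ?_, fun z₀ => ?_⟩
  · rw [hF]
    exact hsupp z t _ (hsel _ (hne z t))
  · have hS : Set.Finite {i | z₀ ∈ tsupport (f i)} := f.locallyFinite.closure.point_finite z₀
    have hae : ∀ᵐ t : I, ∀ i ∈ {i | z₀ ∈ tsupport (f i)}, ((t : ℝ) + 1) / 3 ≠ f i z₀ := by
      rw [ae_ball_iff hS.countable]
      intro i _
      have hsub : {t : I | ¬ ((t : ℝ) + 1) / 3 ≠ f i z₀}.Subsingleton := by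
        intro s hs t ht
        simp only [ne_eq, not_not, mem_ofPred_eq] at hs ht
        exact Subtype.ext (by linarith)
      exact hsub.finite.measure_zero _
    filter_upwards [hae] with t ht
    have h1 := f.locallyFinite.closure.eventually_subset (fun _ => isClosed_closure) z₀
    have h2 : ∀ᶠ z in 𝓝 z₀, ∀ i ∈ {i | z₀ ∈ tsupport (f i)},
        (((t : ℝ) + 1) / 3 < f i z ↔ ((t : ℝ) + 1) / 3 < f i z₀) := by
      rw [eventually_all_finite hS]
      intro i hi
      have hc : Tendsto (fun z => f i z) (𝓝 z₀) (𝓝 (f i z₀)) := (f i).continuous.tendsto z₀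
      rcases lt_or_gt_of_ne (ht i hi) with h | h
      · filter_upwards [hc.eventually (lt_mem_nhds h)] with z hz
        exact iff_of_true hz h
      · filter_upwards [hc.eventually (gt_mem_nhds h)] with z hz
        exact iff_of_false hz.not_gt h.not_gt
    filter_upwards [h1, h2] with z hz1 hz2
    rw [hF, hF]
    refine congrArg sel (Set.ext fun i => ?_)
    by_cases hi : z₀ ∈ tsupport (f i)
    · exact hz2 i hi
    · refine iff_of_false (fun h => hi (hz1 ?_)) fun h => hi ?_
      · exact subset_closure (hsupp z t i h)
      · exact subset_closure (hsupp z₀ t i h)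

/-- Random retractions of a metric space onto a nonempty closed subset: simple random variables
`F y`, with values in compact sets `E y` depending upper hemicontinuously on `y`. -/
theorem exists_random_retraction {Y : Type*} [MetricSpace Y] (X : Set Y) (hX : IsClosed X)
    (hne : X.Nonempty) :
    ∃ (F : Y → SimpleFunc I X) (E : Y → Set X), (∀ (x : X) t, F x t = x) ∧
      (∀ y t, F y t ∈ E y) ∧ (∀ y, IsCompact (E y)) ∧
      (∀ y₀ U, IsOpen U → E y₀ ⊆ U → ∀ᶠ y in 𝓝 y₀, E y ⊆ U) ∧
      ∀ y₀, ∀ᵐ t : I, Tendsto (fun y => F y t) (𝓝 y₀) (𝓝 (F y₀ t)) := by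
  classical
  have hδ : ∀ z : (Xᶜ : Set Y), 0 < Metric.infDist (z : Y) X := fun z =>
    (hX.notMem_iff_infDist_pos hne).1 z.2
  have ha : ∀ z : (Xᶜ : Set Y), ∃ x : X, dist (z : Y) x < 2 * Metric.infDist (z : Y) X := by
    intro z
    obtain ⟨x, hx, h⟩ := (Metric.infDist_lt_iff hne).1
      (show Metric.infDist (z : Y) X < 2 * Metric.infDist (z : Y) X by linarith [hδ z])
    exact ⟨⟨x, hx⟩, h⟩
  choose a ha using ha
  obtain ⟨f, hf⟩ := BumpCovering.exists_isSubordinate (s := (univ : Set (Xᶜ : Set Y))) isClosed_univ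
    (fun z : (Xᶜ : Set Y) => Metric.ball z (Metric.infDist (z : Y) X / 4))
    (fun _ => Metric.isOpen_ball)
    (fun z _ => mem_iUnion.2 ⟨z, Metric.mem_ball_self (by linarith [hδ z])⟩)
  obtain ⟨G, hG, hGae⟩ := exists_random_index f
  have hdist : ∀ z i, z ∈ tsupport (f i) → dist (z : Y) (a i) ≤ 3 * Metric.infDist (z : Y) X := by
    intro z i hz
    have h1 : dist (z : Y) i < Metric.infDist (i : Y) X / 4 := hf i hz
    have h2 := Metric.infDist_le_infDist_add_dist (s := X) (x := (i : Y)) (y := z)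
    rw [dist_comm] at h2
    have h3 := dist_triangle (z : Y) i (a i)
    linarith [ha i]
  let F : Y → SimpleFunc I X := fun y =>
    if h : y ∈ X then SimpleFunc.const I ⟨y, h⟩ else (G ⟨y, h⟩).map a
  let E : Y → Set X := fun y =>
    if h : y ∈ X then {⟨y, h⟩} else a '' {i | (⟨y, h⟩ : (Xᶜ : Set Y)) ∈ tsupport (f i)}
  have hFX : ∀ (x : X), F x = SimpleFunc.const I x := fun x => dif_pos x.2
  have hEX : ∀ (x : X), E x = {x} := fun x => dif_pos x.2
  have hFZ : ∀ (z : (Xᶜ : Set Y)), F z = (G z).map a := fun z => dif_neg z.2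
  have hEZ : ∀ (z : (Xᶜ : Set Y)), E z = a '' {i | z ∈ tsupport (f i)} := fun z => dif_neg z.2
  have cases_on : ∀ {P : Y → Prop}, (∀ x : X, P x) → (∀ z : (Xᶜ : Set Y), P z) → ∀ y, P y :=
    fun hx hz y => if h : y ∈ X then hx ⟨y, h⟩ else hz ⟨y, h⟩
  have hFE : ∀ y t, F y t ∈ E y := by
    refine cases_on (fun x t => ?_) fun z t => ?_
    · rw [hFX, hEX]
      rfl
    · rw [hFZ, hEZ]
      exact mem_image_of_mem a (hG z t)
  have hEd : ∀ y, ∀ x ∈ E y, dist y (x : Y) ≤ 3 * Metric.infDist y X := by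
    refine cases_on (fun x => ?_) fun z => ?_
    · rw [hEX]
      rintro _ rfl
      simp [Metric.infDist_nonneg]
    · rw [hEZ]
      rintro _ ⟨i, hi, rfl⟩
      exact hdist z i hi
  have hmap : ∀ z : (Xᶜ : Set Y), map ((↑) : (Xᶜ : Set Y) → Y) (𝓝 z) = 𝓝 (z : Y) := fun z =>
    map_nhds_subtype_coe_eq_nhds z.2 (hX.isOpen_compl.mem_nhds z.2)
  have husc : ∀ y₀ U, IsOpen U → E y₀ ⊆ U → ∀ᶠ y in 𝓝 y₀, E y ⊆ U := by
    refine cases_on (fun x U hU hx => ?_) fun z U hU hz => ?_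
    · rw [hEX, singleton_subset_iff] at hx
      obtain ⟨ε, hε, hεU⟩ := Metric.isOpen_iff.1 hU x hx
      filter_upwards [Metric.ball_mem_nhds (x : Y) (show 0 < ε / 4 by linarith)] with y hy x' hx'
      refine hεU ?_
      have h1 := hEd y x' hx'
      have h2 : Metric.infDist y X ≤ dist y x := Metric.infDist_le_dist_of_mem x.2
      have h3 := dist_triangle_left (x' : Y) x y
      rw [Metric.mem_ball] at hy
      change dist (x' : Y) x < ε
      linarith
    · rw [← hmap, eventually_map]
      filter_upwards [f.locallyFinite.closure.eventually_subset (fun _ => isClosed_closure) z]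
        with z' hz'
      refine Subset.trans ?_ hz
      rw [hEZ, hEZ]
      exact image_mono hz'
  refine ⟨F, E, fun x t => by rw [hFX]; rfl, hFE, ?_, husc, ?_⟩
  · refine cases_on (fun x => ?_) fun z => ?_
    · rw [hEX]
      exact isCompact_singleton
    · rw [hEZ]
      exact ((f.locallyFinite.closure.point_finite z).image a).isCompact
  · refine cases_on (fun x => Eventually.of_forall fun t => ?_) fun z => ?_
    · rw [hFX]
      refine tendsto_nhds.2 fun U hU hx => ?_
      filter_upwards [husc x U hU (by rw [hEX]; exact singleton_subset_iff.2 hx)] with y hy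
      exact hy (hFE y t)
    · filter_upwards [hGae z] with t ht
      rw [← hmap, tendsto_map'_iff]
      refine tendsto_const_nhds.congr' ?_
      filter_upwards [ht] with z' hz'
      simp only [Function.comp_apply, hFZ, SimpleFunc.map_apply, hz']

/-- The union of an upper hemicontinuous family of compact sets over a compact set is compact. -/
theorem isCompact_biUnion_of_upperHemicontinuous {Y X : Type*} [TopologicalSpace Y]
    [TopologicalSpace X] {E : Y → Set X} (hE : ∀ y, IsCompact (E y))
    (husc : ∀ y₀ U, IsOpen U → E y₀ ⊆ U → ∀ᶠ y in 𝓝 y₀, E y ⊆ U) {D : Set Y} (hD : IsCompact D) :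
    IsCompact (⋃ y ∈ D, E y) := by
  classical
  refine isCompact_of_finite_subcover fun {ι} U hU hcov => ?_
  refine hD.induction_on (p := fun s => ∃ t : Finset ι, ⋃ y ∈ s, E y ⊆ ⋃ i ∈ t, U i)
    ⟨∅, by simp⟩ (fun s s' hs ⟨t, ht⟩ => ⟨t, (biUnion_mono hs fun _ _ => Subset.rfl).trans ht⟩)
    (fun s s' ⟨t, ht⟩ ⟨t', ht'⟩ => ⟨t ∪ t', ?_⟩) fun y hy => ?_
  · rw [biUnion_union, Finset.set_biUnion_union]
    exact union_subset_union ht ht'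
  · obtain ⟨t, ht⟩ := (hE y).elim_finite_subcover U hU ((subset_biUnion_of_mem hy).trans hcov)
    exact ⟨_, mem_nhdsWithin_of_mem_nhds
      (husc y _ (isOpen_biUnion fun i _ => hU i) ht), t, iUnion₂_subset fun _ h => h⟩

/-- The expectation of `p` at a pair of simple random variables. -/
noncomputable def extend {Y X : Type*} (F : Y → SimpleFunc I X) (p : X × X → ℝ) (w : Y × Y) : ℝ :=
  ∫ t : I, p (F w.1 t, F w.2 t)

section extend

variable {Y X : Type*} (F : Y → SimpleFunc I X)

theorem integrable_extend (p : X × X → ℝ) (y y' : Y) :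
    Integrable (fun t : I => p (F y t, F y' t)) :=
  (((F y).pair (F y')).map p).integrable_of_isFiniteMeasure

theorem isPseudometric_extend {p : X × X → ℝ} (hp : IsPseudometric p) :
    IsPseudometric (extend F p) := by
  obtain ⟨h0, hd, hs, ht⟩ := hp
  refine ⟨fun x y => integral_nonneg fun t => h0 _ _, fun x => ?_, fun x y => ?_, fun x y z => ?_⟩
  · simp [extend, hd]
  · simp only [extend]
    exact integral_congr_ae (Eventually.of_forall fun t => hs _ _)
  · simp only [extend]
    rw [← integral_add (integrable_extend F p x y) (integrable_extend F p y z)]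
    exact integral_mono (integrable_extend F p x z)
      ((integrable_extend F p x y).add (integrable_extend F p y z)) fun t => ht _ _ _

theorem abs_extend_le {p : X × X → ℝ} {w : Y × Y} (h : ∀ t, |p (F w.1 t, F w.2 t)| ≤ 1) :
    |extend F p w| ≤ 1 := by
  have := norm_integral_le_of_norm_le_const (μ := (volume : Measure I))
    (f := fun t => p (F w.1 t, F w.2 t)) (C := 1) (Eventually.of_forall h)
  simpa [extend] using this

theorem continuous_extend [TopologicalSpace Y] [FirstCountableTopology Y] [TopologicalSpace X]
    {E : Y → Set X} (hFE : ∀ y t, F y t ∈ E y) (hE : ∀ y, IsCompact (E y))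
    (husc : ∀ y₀ U, IsOpen U → E y₀ ⊆ U → ∀ᶠ y in 𝓝 y₀, E y ⊆ U)
    (hF : ∀ y₀, ∀ᵐ t : I, Tendsto (fun y => F y t) (𝓝 y₀) (𝓝 (F y₀ t)))
    {p : X × X → ℝ} (hp : Continuous p) : Continuous (extend F p) := by
  refine continuous_iff_continuousAt.2 fun ⟨y, y'⟩ => ?_
  obtain ⟨M, hM⟩ := ((hE y).prod (hE y')).exists_bound_of_continuousOn hp.continuousOn
  obtain ⟨U, V, hU, hV, hyU, hyV, hUV⟩ := generalized_tube_lemma (hE y) (hE y')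
    (isOpen_lt hp.norm continuous_const : IsOpen {q | ‖p q‖ < M + 1})
    fun q hq => (hM q hq).trans_lt (lt_add_one M)
  refine tendsto_integral_filter_of_dominated_convergence (fun _ => M + 1)
    (Eventually.of_forall fun w => (integrable_extend F p w.1 w.2).aestronglyMeasurable) ?_
    (integrable_const _) ?_
  · rw [nhds_prod_eq]
    filter_upwards [(husc y U hU hyU).prod_mk (husc y' V hV hyV)] with w hw
    exact Eventually.of_forall fun t =>
      (hUV (mk_mem_prod (hw.1 (hFE w.1 t)) (hw.2 (hFE w.2 t))) : ‖p _‖ < M + 1).le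
  · filter_upwards [hF y, hF y'] with t ht ht'
    exact (hp.tendsto _).comp (((ht.comp (continuous_fst.tendsto (y, y'))).prodMk_nhds
      (ht'.comp (continuous_snd.tendsto (y, y')))))

end extend

theorem isRegularExtensionOperator_extend {Y : Type*} {X : Set Y} {F : Y → SimpleFunc I X}
    (hF : ∀ (x : X) t, F x t = x) : IsRegularExtensionOperator X (extend F) := by
  refine ⟨fun p q a b => funext fun w => ?_, fun p hp w => integral_nonneg fun t => hp _, ?_,
    fun p x x' => ?_⟩
  · simp only [extend]
    rw [integral_add ((integrable_extend F p _ _).const_mul a)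
      ((integrable_extend F q _ _).const_mul b), integral_const_mul, integral_const_mul]
  · funext w
    simp [extend]
  · simp [extend, hF]

end RegularExtension


theorem exists_regular_extension_operator_compactOpen {Y : Type*} [TopologicalSpace Y]
    [TopologicalSpace.MetrizableSpace Y]
    (X : Set Y) (hX : IsClosed X)
    (x₁ x₂ : Y) (hx₁ : x₁ ∈ X) (hx₂ : x₂ ∈ X) (hne : x₁ ≠ x₂) :
    ∃ T : (↥X × ↥X → ℝ) → (Y × Y → ℝ),
      IsRegularExtensionOperator X T ∧
      (∀ p : ↥X × ↥X → ℝ, Continuous p → Continuous (T p)) ∧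
      (∀ p : ↥X × ↥X → ℝ, IsPseudometric p → IsPseudometric (T p)) ∧
      (∀ C : Set (Y × Y), IsCompact C → ∃ K : Set ↥X, IsCompact K ∧
        ∀ p : ↥X × ↥X → ℝ, (∀ x ∈ K, ∀ x' ∈ K, |p (x, x')| ≤ 1) →
          ∀ w ∈ C, |T p w| ≤ 1) := by
  let := TopologicalSpace.metrizableSpaceMetric Y
  obtain ⟨F, E, hFX, hFE, hE, husc, hF⟩ :=
    RegularExtension.exists_random_retraction X hX ⟨x₁, hx₁⟩
  refine ⟨RegularExtension.extend F, RegularExtension.isRegularExtensionOperator_extend hFX,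
    fun p hp => RegularExtension.continuous_extend F hFE hE husc hF hp,
    fun p hp => RegularExtension.isPseudometric_extend F hp, fun C hC => ?_⟩
  refine ⟨⋃ y ∈ Prod.fst '' C ∪ Prod.snd '' C, E y,
    RegularExtension.isCompact_biUnion_of_upperHemicontinuous hE husc
      ((hC.image continuous_fst).union (hC.image continuous_snd)), fun p hp w hw => ?_⟩
  exact RegularExtension.abs_extend_le F fun t => hp
    _ (mem_biUnion (Or.inl (mem_image_of_mem _ hw)) (hFE w.1 t))
    _ (mem_biUnion (Or.inr (mem_image_of_mem _ hw)) (hFE w.2 t))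
end
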